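/- Corollary 2. Suppose r > 2 or p > 2, and suppose the union over t in Y_v of the sets P_t equals the singleton {(i,j)}, i.e., a single pair (i,j) achieves the minimum defining T (though possibly in several VN types t in Y_v). Then G(alpha) = (T/psi) alpha log alpha + K alpha + O(alpha^xi), where K = (1/i) [ log( i sum_{t in Y_v} B_{i,j}^{(t)} delta_t ) + (j/r) log C + (j/psi) log( j int_lambda / i ) ] - T/psi and xi = min{rbar/r, chi/psi + 1, 2}. -/

import Mathlib

open Filter Polynomial Finset
open scoped Classical

/-- An irregular doubly-generalized LDPC (D-GLDPC) code ensemble, specified by: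
check-node (CN) types `Fin nc` with lengths `s`, dimensions `hdim`, minimum distances `rd`,
weight enumerator coefficients `A`; variable-node (VN) types `Fin nv` with dimensions `kdim`,
lengths `q`, minimum distances `pd`, input-output weight enumerator coefficients `B`;
and edge fractions `ρ` (CN side) and `lam` (VN side). -/
structure DGLDPC where
  nc : ℕ
  nv : ℕ
  hnc : 0 < nc
  hnv : 0 < nv
  s : Fin nc → ℕ
  hdim : Fin nc → ℕ
  rd : Fin nc → ℕ
  A : Fin nc → ℕ → ℕ
  kdim : Fin nv → ℕ
  q : Fin nv → ℕ
  pd : Fin nv → ℕ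
  B : Fin nv → ℕ → ℕ → ℕ
  ρ : Fin nc → ℝ
  lam : Fin nv → ℝ
  h_hdim : ∀ t, 1 ≤ hdim t
  h_hs : ∀ t, hdim t < s t
  h_rd2 : ∀ t, 2 ≤ rd t
  h_rds : ∀ t, rd t ≤ s t
  hA0 : ∀ t, A t 0 = 1
  hAsupp : ∀ t u, u ≠ 0 → (u < rd t ∨ s t < u) → A t u = 0
  hAr : ∀ t, 0 < A t (rd t)
  h_k1 : ∀ t, 1 ≤ kdim t
  h_q1 : ∀ t, 1 ≤ q t
  h_pd2 : ∀ t, 2 ≤ pd t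
  h_pdq : ∀ t, pd t ≤ q t
  hB00 : ∀ t, B t 0 0 = 1
  hBsupp : ∀ t u v, ¬(u = 0 ∧ v = 0) →
    ¬(1 ≤ u ∧ u ≤ kdim t ∧ pd t ≤ v ∧ v ≤ q t) → B t u v = 0
  hBp : ∀ t, ∃ u, 0 < B t u (pd t)
  hρpos : ∀ t, 0 < ρ t
  hlampos : ∀ t, 0 < lam t
  hρsum : ∑ t, ρ t = 1
  hlamsum : ∑ t, lam t = 1

namespace DGLDPC

variable (M : DGLDPC)

/-- `∫ρ = ∑_t ρ_t / s_t`. -/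
noncomputable def intrho : ℝ := ∑ t, M.ρ t / (M.s t : ℝ)

/-- `∫λ = ∑_t λ_t / q_t`. -/
noncomputable def intlam : ℝ := ∑ t, M.lam t / (M.q t : ℝ)

/-- Fraction `δ_t = λ_t / (q_t ∫λ)` of VNs of type `t`. -/
noncomputable def δfrac (t : Fin M.nv) : ℝ := M.lam t / ((M.q t : ℝ) * M.intlam)

/-- `r`: the smallest CN minimum distance. -/
noncomputable def r : ℕ := sInf (Set.range M.rd)

/-- `p`: the smallest VN minimum distance. -/
noncomputable def p : ℕ := sInf (Set.range M.pd)

/-- `ψ = r/(r-1)`. -/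
noncomputable def ψ : ℝ := (M.r : ℝ) / ((M.r : ℝ) - 1)

/-- `C = r ∑_{t ∈ X_c} ρ_t A_r^{(t)} / s_t`, sum over CN types of minimum distance `r`. -/
noncomputable def Cparam : ℝ :=
  (M.r : ℝ) * ∑ t ∈ Finset.univ.filter (fun t => M.rd t = M.r),
    M.ρ t * (M.A t M.r : ℝ) / (M.s t : ℝ)

/-- `T_{i,j} = (j - ψ)/i`. -/
noncomputable def Tij (i j : ℕ) : ℝ := ((j : ℝ) - M.ψ) / (i : ℝ)

/-- `S⁻`: pairs `(i,j) ≠ (0,0)` with `B_{i,j}^{(t)} > 0` for some VN type `t`. -/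
def Sminus : Set (ℕ × ℕ) := {ij | (∃ t, 0 < M.B t ij.1 ij.2) ∧ ij ≠ (0, 0)}

/-- `T = min_{(i,j) ∈ S⁻} T_{i,j}`. -/
noncomputable def T : ℝ := sInf {x : ℝ | ∃ ij ∈ M.Sminus, x = M.Tij ij.1 ij.2}

/-- The set of candidate exponents whose infimum is
`ξ = min { r̄/r, χ/ψ + 1, 2 }` (terms coming from empty families being dropped):
it contains `2`, the values `i/r` for `i > r` with `A_i^{(t)} > 0` for some `t`
(whose minimum is `r̄/r`), and the values `(T_{i,j} - T) i / ψ + 1` for `(i,j) ∈ S⁻`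
with `T_{i,j} > T` (whose minimum is `χ/ψ + 1`). -/
noncomputable def xiSet : Set ℝ :=
  {2} ∪ {x : ℝ | ∃ i : ℕ, M.r < i ∧ (∃ t, 0 < M.A t i) ∧ x = (i : ℝ) / (M.r : ℝ)}
    ∪ {x : ℝ | ∃ ij ∈ M.Sminus, M.T < M.Tij ij.1 ij.2 ∧
        x = (M.Tij ij.1 ij.2 - M.T) * (ij.1 : ℝ) / M.ψ + 1}

/-- The exponent `ξ = min { r̄/r, χ/ψ + 1, 2 }`. -/
noncomputable def ξexp : ℝ := sInf M.xiSet

/-- The polynomial `Q₁(x)`; the sum effectively ranges over `t ∈ Y_v` and `(i,j) ∈ P_t`,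
i.e. over all `(t,i,j)` with `(i,j) ∈ S_t⁻` and `T_{i,j} = T`. -/
noncomputable def Q1 (x : ℝ) : ℝ :=
  ∑ t, (M.lam t / (M.q t : ℝ)) *
    ∑ i ∈ Finset.range (M.kdim t + 1), ∑ j ∈ Finset.range (M.q t + 1),
      if 0 < M.B t i j ∧ (i, j) ≠ (0, 0) ∧ M.Tij i j = M.T then
        (j : ℝ) * (M.B t i j : ℝ) * M.Cparam ^ ((j : ℝ) / (M.r : ℝ)) *
          (M.intlam / Real.exp 1) ^ ((i : ℝ) * M.T / M.ψ) * x ^ i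
      else 0

/-- The polynomial `Q₂(x)`. -/
noncomputable def Q2 (x : ℝ) : ℝ :=
  ∑ t, (M.lam t / (M.q t : ℝ)) *
    ∑ i ∈ Finset.range (M.kdim t + 1), ∑ j ∈ Finset.range (M.q t + 1),
      if 0 < M.B t i j ∧ (i, j) ≠ (0, 0) ∧ M.Tij i j = M.T then
        (i : ℝ) * (M.B t i j : ℝ) * M.Cparam ^ ((j : ℝ) / (M.r : ℝ)) *
          (M.intlam / Real.exp 1) ^ ((i : ℝ) * M.T / M.ψ) * x ^ i
      else 0

/-- Number of Tanner graph edges, `E = n/∫λ` (exact on admissible `n`). -/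
noncomputable def En (n : ℕ) : ℕ := ⌊(n : ℝ) / M.intlam⌋₊

/-- Number of CNs of type `t`, `γ_t m = E ρ_t / s_t` (exact on admissible `n`). -/
noncomputable def cExp (n : ℕ) (t : Fin M.nc) : ℕ := ⌊(M.En n : ℝ) * M.ρ t / (M.s t : ℝ)⌋₊

/-- Number of VNs of type `t`, `δ_t n = E λ_t / q_t` (exact on admissible `n`). -/
noncomputable def vExp (n : ℕ) (t : Fin M.nv) : ℕ := ⌊(M.En n : ℝ) * M.lam t / (M.q t : ℝ)⌋₊

/-- The CN weight enumerating polynomial `A^{(t)}(x)`. -/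
noncomputable def Apoly (t : Fin M.nc) : Polynomial ℝ :=
  ∑ u ∈ Finset.range (M.s t + 1), Polynomial.C ((M.A t u : ℕ) : ℝ) * Polynomial.X ^ u

/-- The VN bivariate weight enumerating polynomial `B^{(t)}(x,y)`, with the outer
variable recording input weight and the inner variable recording output weight. -/
noncomputable def Bpoly (t : Fin M.nv) : Polynomial (Polynomial ℝ) :=
  ∑ u ∈ Finset.range (M.kdim t + 1),
    Polynomial.C (∑ v ∈ Finset.range (M.q t + 1),
      Polynomial.C ((M.B t u v : ℕ) : ℝ) * Polynomial.X ^ v) * Polynomial.X ^ u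

/-- `N_c(v)`: the number of check-valid assignments of weight `v`, i.e. the coefficient
of `x^v` in `∏_t (A^{(t)}(x))^{γ_t m}`. -/
noncomputable def NcCount (n v : ℕ) : ℝ := (∏ t, M.Apoly t ^ M.cExp n t).coeff v

/-- `N_v(u,v)`: the coefficient of `x^u y^v` in `∏_t (B^{(t)}(x,y))^{δ_t n}`. -/
noncomputable def NvCount (n u v : ℕ) : ℝ := ((∏ t, M.Bpoly t ^ M.vExp n t).coeff u).coeff v

/-- The expected number of codewords of weight `w`:
`E[N_w] = ∑_v N_v(w,v) N_c(v) / binom(E,v)`. -/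
noncomputable def ENw (n w : ℕ) : ℝ :=
  ∑ v ∈ Finset.range (M.En n + 1),
    M.NvCount n w v * M.NcCount n v / ((M.En n).choose v : ℝ)

/-- `n` is admissible for `α` when all the relevant quantities (`E`, the numbers of
CNs and VNs of each type, and the codeword weight `α n`) are integers and the
expected number of weight-`α n` codewords is positive. -/
def Adm (α : ℝ) (n : ℕ) : Prop :=
  0 < n ∧ ((M.En n : ℝ) = (n : ℝ) / M.intlam) ∧
  (∀ t, (M.cExp n t : ℝ) = (M.En n : ℝ) * M.ρ t / (M.s t : ℝ)) ∧
  (∀ t, (M.vExp n t : ℝ) = (M.En n : ℝ) * M.lam t / (M.q t : ℝ)) ∧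
  ((⌊α * (n : ℝ)⌋₊ : ℝ) = α * (n : ℝ)) ∧
  0 < M.ENw n ⌊α * (n : ℝ)⌋₊

/-- The sequence `(1/n) log E[N_{αn}]` whose limit (along admissible `n`) is `G(α)`. -/
noncomputable def grSeq (α : ℝ) (n : ℕ) : ℝ :=
  (1 / (n : ℝ)) * Real.log (M.ENw n ⌊α * (n : ℝ)⌋₊)

end DGLDPC


lemma aux_log_fact_ge (k : ℕ) : (k : ℝ) * Real.log k - k ≤ Real.log (k.factorial : ℝ) := by
  rcases Nat.eq_zero_or_pos k with rfl | hk
  · simp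
  have hk' : (0:ℝ) < k := by exact_mod_cast hk
  have hf : (0:ℝ) < (k.factorial : ℝ) := by exact_mod_cast k.factorial_pos
  have h := Real.pow_div_factorial_le_exp (k : ℝ) hk'.le k
  have h2 := Real.log_le_log (by positivity) h
  rw [Real.log_exp, Real.log_div (by positivity) (by positivity), Real.log_pow] at h2
  linarith

lemma aux_log_fact_le (k : ℕ) (hk : 1 ≤ k) :
    Real.log (k.factorial : ℝ) ≤ (k : ℝ) * Real.log k - k + Real.log k + 1 := by
  induction k, hk using Nat.le_induction with
  | base => simp
  | succ k hk ih =>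
    have hk' : (0:ℝ) < k := by exact_mod_cast hk
    have hf : (0:ℝ) < (k.factorial : ℝ) := by exact_mod_cast k.factorial_pos
    rw [Nat.factorial_succ]
    push_cast
    rw [Real.log_mul (by positivity) (by positivity)]
    have h1 : 1 - ((((k:ℝ)+1)/k))⁻¹ ≤ Real.log (((k:ℝ)+1)/k) := Real.one_sub_inv_le_log_of_pos (by positivity)
    rw [Real.log_div (by positivity) (by positivity)] at h1
    have h2 : 1 - ((((k:ℝ)+1)/k))⁻¹ = 1/((k:ℝ)+1) := by field_simp; ring
    rw [h2] at h1
    have h3 : ((k:ℝ)+1) * (1/((k:ℝ)+1)) ≤ ((k:ℝ)+1) * (Real.log ((k:ℝ)+1) - Real.log k) :=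
      mul_le_mul_of_nonneg_left h1 (by positivity)
    have h4 : ((k:ℝ)+1) * (1/((k:ℝ)+1)) = 1 := by field_simp
    nlinarith

lemma aux_choose_x (E v : ℕ) (hE : 1 ≤ E) (hv : v ≤ E) :
    ∃ x : ℝ, 0 < x ∧ (E:ℝ) * Real.log (1 + x) - v * Real.log x ≤
      Real.log (E.choose v : ℝ) + 2 * Real.log E + 2 := by
  have hE' : (0:ℝ) < E := by exact_mod_cast hE
  have hlE : 0 ≤ Real.log (E:ℝ) := Real.log_nonneg (by exact_mod_cast hE)
  have key : (E:ℝ) * Real.log (1 + 1 / (E:ℝ)) ≤ 1 := by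
    have h1 : Real.log (1 + 1/(E:ℝ)) ≤ 1/(E:ℝ) := by
      have := Real.log_le_sub_one_of_pos (show (0:ℝ) < 1 + 1/(E:ℝ) by positivity)
      linarith
    calc (E:ℝ) * Real.log (1 + 1 / (E:ℝ)) ≤ E * (1/(E:ℝ)) := by gcongr
      _ = 1 := by field_simp
  rcases Nat.eq_zero_or_pos v with rfl | hv0
  · refine ⟨1/E, by positivity, ?_⟩
    simp only [Nat.cast_zero, Nat.choose_zero_right, Nat.cast_one, Real.log_one]
    linarith
  rcases Nat.eq_or_lt_of_le hv with rfl | hlt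
  · refine ⟨v, by positivity, ?_⟩
    have : Real.log (1 + (v:ℝ)) = Real.log (1 + 1/(v:ℝ)) + Real.log v := by
      rw [← Real.log_mul (by positivity) (by positivity)]
      congr 1; field_simp; ring
    rw [this]
    simp only [Nat.choose_self, Nat.cast_one, Real.log_one]
    linarith
  obtain ⟨d, rfl⟩ := Nat.exists_eq_add_of_lt hlt
  set m := d + 1 with hm
  have e : v + d + 1 = v + m := by omega
  rw [e] at *
  have hv' : (0:ℝ) < v := by exact_mod_cast hv0
  have hm' : (0:ℝ) < m := by rw [hm]; positivity
  refine ⟨v / m, by positivity, ?_⟩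
  have h1 := aux_log_fact_le v hv0
  have h2 := aux_log_fact_le m (by omega)
  have h3 := aux_log_fact_ge (v + m)
  have h4 : ((v+m).choose v * v.factorial * m.factorial : ℝ) = ((v+m).factorial : ℝ) := by
    have := Nat.choose_mul_factorial_mul_factorial hv
    rw [show v + d + 1 - v = m by omega] at this
    exact_mod_cast this
  have hc : (0:ℝ) < ((v+m).choose v : ℝ) := by exact_mod_cast Nat.choose_pos hv
  have hf1 : (0:ℝ) < (v.factorial : ℝ) := by exact_mod_cast v.factorial_pos
  have hf2 : (0:ℝ) < (m.factorial : ℝ) := by exact_mod_cast m.factorial_pos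
  have h5 := congrArg Real.log h4
  rw [Real.log_mul (by positivity) (by positivity), Real.log_mul (by positivity) (by positivity)] at h5
  have h6 : (1 + (v:ℝ)/m) = ((v + m : ℕ):ℝ) / m := by push_cast; field_simp; ring
  rw [h6, Real.log_div (by positivity) (by positivity), Real.log_div (by positivity) (by positivity)]
  have h7 : Real.log v ≤ Real.log ((v+m:ℕ):ℝ) := Real.log_le_log hv' (by push_cast; linarith)
  have h8 : Real.log m ≤ Real.log ((v+m:ℕ):ℝ) := Real.log_le_log hm' (by push_cast; linarith)
  push_cast at *
  nlinarith

lemma aux_choose_le (N V : ℕ) (x : ℝ) (hx : 0 < x) (hV : V ≤ N) :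
    Real.log (N.choose V : ℝ) ≤ (N:ℝ) * Real.log (1 + x) - V * Real.log x := by
  have hc : (0:ℝ) < (N.choose V : ℝ) := by exact_mod_cast Nat.choose_pos hV
  have h : (N.choose V : ℝ) * x ^ V ≤ (1 + x) ^ N := by
    rw [add_comm, add_pow]
    have := Finset.single_le_sum (f := fun m => x ^ m * 1 ^ (N - m) * (N.choose m : ℝ))
      (fun m _ => by positivity) (Finset.mem_range.2 (Nat.lt_succ_of_le hV))
    simpa [mul_comm] using this
  have h2 := Real.log_le_log (by positivity) h
  rw [Real.log_mul (by positivity) (by positivity), Real.log_pow, Real.log_pow] at h2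
  linarith

lemma aux_fekete (S : Set ℕ) (a : ℕ → ℝ) (c U : ℝ) (hS : S.Infinite) (hS0 : ∀ n ∈ S, 0 < n)
    (hU : ∀ n ∈ S, a n ≤ n * U + (4 * Real.log n + c))
    (hsup : ∀ n₁ ∈ S, ∀ n₀ ∈ S, ∃ κ : ℝ, ∀ k : ℕ, n₀ + k * n₁ ∈ S →
      κ + k * (a n₁ - (4 * Real.log n₁ + c)) ≤ a (n₀ + k * n₁)) :
    ∃ G : ℝ, Tendsto (fun n : ℕ => 1 / (n:ℝ) * a n) (atTop ⊓ 𝓟 S) (nhds G) := by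
  set P : ℕ → ℝ := fun n => 4 * Real.log n + c with hP
  set b : ℕ → ℝ := fun n => (a n - P n) / n with hb
  have hbU : ∀ n ∈ S, b n ≤ U := by
    intro n hn
    have h0 : (0:ℝ) < n := by exact_mod_cast hS0 n hn
    rw [hb]; simp only
    rw [div_le_iff₀ h0]
    have := hU n hn
    simp only [hP]; linarith
  have hbdd : BddAbove (b '' S) := ⟨U, by rintro _ ⟨n, hn, rfl⟩; exact hbU n hn⟩
  have hne : (b '' S).Nonempty := hS.nonempty.image b
  set G := sSup (b '' S) with hG
  have hPlim : Tendsto (fun n : ℕ => P n / n) atTop (nhds 0) := by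
    have h1 : Tendsto (fun n : ℕ => Real.log n / n) atTop (nhds 0) := by
      have := (Real.isLittleO_log_id_atTop.tendsto_div_nhds_zero).comp (tendsto_natCast_atTop_atTop (R := ℝ))
      simpa [Function.comp_def] using this
    have h2 : Tendsto (fun n : ℕ => c / (n:ℝ)) atTop (nhds 0) := tendsto_const_div_atTop_nhds_zero_nat c
    have := (h1.const_mul 4).add h2
    simp only [mul_zero, add_zero] at this
    refine this.congr (fun n => ?_)
    simp only [hP]; ring
  refine ⟨G, ?_⟩
  rw [Metric.tendsto_nhds]
  intro ε hε
  -- upper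
  have hup : ∀ᶠ n : ℕ in atTop ⊓ 𝓟 S, 1 / (n:ℝ) * a n < G + ε := by
    have h1 : ∀ᶠ n : ℕ in atTop, P n / n < ε := hPlim.eventually (gt_mem_nhds hε)
    rw [eventually_inf_principal]
    filter_upwards [h1] with n hn hnS
    have h0 : (0:ℝ) < n := by exact_mod_cast hS0 n hnS
    have h2 : b n ≤ G := le_csSup hbdd ⟨n, hnS, rfl⟩
    have h3 : 1 / (n:ℝ) * a n = b n + P n / n := by simp only [hb]; field_simp; ring
    rw [h3]; linarith
  have hlow : ∀ᶠ n : ℕ in atTop ⊓ 𝓟 S, G - ε < 1 / (n:ℝ) * a n := by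
    obtain ⟨_, ⟨n₁, hn₁, rfl⟩, hlt⟩ := exists_lt_of_lt_csSup hne (show G - ε / 2 < G by linarith)
    have hn10 := hS0 n₁ hn₁
    have hn1' : (0:ℝ) < n₁ := by exact_mod_cast hn10
    have hres : ∀ c : ℕ, ∃ K : ℝ, 0 ≤ K ∧ ∀ n ∈ S, n % n₁ = c → (n:ℝ) * b n₁ - K ≤ a n := by
      intro c
      by_cases hex : ∃ n, n ∈ S ∧ n % n₁ = c
      · obtain ⟨hm1, hm2⟩ := Nat.find_spec hex
        set n₀ := Nat.find hex with hn₀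
        obtain ⟨κ, hκ⟩ := hsup n₁ hn₁ n₀ hm1
        refine ⟨|κ - n₀ * b n₁|, abs_nonneg _, ?_⟩
        intro n hn hnc
        have hle : n₀ ≤ n := Nat.find_min' hex ⟨hn, hnc⟩
        have hmod : n₁ ∣ n - n₀ := (Nat.modEq_iff_dvd' hle).1 (by rw [Nat.ModEq, hm2, hnc])
        obtain ⟨k, hk⟩ := hmod
        have hn_eq : n = n₀ + k * n₁ := by rw [mul_comm k, ← hk]; omega
        have h1 := hκ k (hn_eq ▸ hn)
        rw [← hn_eq] at h1
        have h2 : (n:ℝ) = n₀ + k * n₁ := by exact_mod_cast hn_eq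
        have h3 : (n₁:ℝ) * b n₁ = a n₁ - P n₁ := by simp only [hb]; field_simp
        have h4 := neg_abs_le (κ - n₀ * b n₁)
        rw [h2]
        have h5 : κ + k * (a n₁ - P n₁) ≤ a n := h1
        rw [← h3] at h5
        nlinarith
      · exact ⟨0, le_rfl, fun n hn hnc => absurd ⟨n, hn, hnc⟩ hex⟩
    choose K hK0 hK using hres
    set KK := ∑ c ∈ Finset.range n₁, K c with hKK
    have hall : ∀ n ∈ S, (n:ℝ) * b n₁ - KK ≤ a n := by
      intro n hn
      have h1 := hK (n % n₁) n hn rfl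
      have h2 : K (n % n₁) ≤ KK := Finset.single_le_sum (f := K) (fun c _ => hK0 c)
        (Finset.mem_range.2 (Nat.mod_lt _ hn10))
      linarith
    have h1 : ∀ᶠ n : ℕ in atTop, KK / n < ε / 2 :=
      (tendsto_const_div_atTop_nhds_zero_nat KK).eventually (gt_mem_nhds (by linarith))
    rw [eventually_inf_principal]
    filter_upwards [h1] with n hn hnS
    have h0 : (0:ℝ) < n := by exact_mod_cast hS0 n hnS
    have h2 := hall n hnS
    have h3 : b n₁ - KK / n ≤ 1 / (n:ℝ) * a n := by
      have : b n₁ - KK / n = 1 / (n:ℝ) * (n * b n₁ - KK) := by field_simp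
      rw [this]; gcongr
    linarith
  filter_upwards [hup, hlow] with n h1 h2
  rw [Real.dist_eq, abs_lt]
  constructor <;> linarith

def AuxNN (P : ℝ[X][X]) : Prop := ∀ u v, 0 ≤ (P.coeff u).coeff v

lemma aux_coeff_mul (P Q : ℝ[X][X]) (u v : ℕ) :
    ((P * Q).coeff u).coeff v = ∑ x ∈ antidiagonal u, ∑ y ∈ antidiagonal v,
      (P.coeff x.1).coeff y.1 * (Q.coeff x.2).coeff y.2 := by
  rw [coeff_mul, finsetSum_coeff]
  refine Finset.sum_congr rfl (fun x _ => ?_)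
  rw [coeff_mul]

lemma AuxNN.one : AuxNN 1 := by
  intro u v
  rw [coeff_one]
  split_ifs
  · rw [coeff_one]; split_ifs <;> norm_num
  · simp

lemma AuxNN.mul {P Q : ℝ[X][X]} (hP : AuxNN P) (hQ : AuxNN Q) : AuxNN (P * Q) := by
  intro u v
  rw [aux_coeff_mul]
  exact Finset.sum_nonneg fun x _ => Finset.sum_nonneg fun y _ => mul_nonneg (hP _ _) (hQ _ _)

lemma AuxNN.pow {P : ℝ[X][X]} (hP : AuxNN P) (n : ℕ) : AuxNN (P ^ n) := by
  induction n with
  | zero => simpa using AuxNN.one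
  | succ n ih => rw [pow_succ]; exact ih.mul hP

lemma AuxNN.prod {ι : Type*} (s : Finset ι) (P : ι → ℝ[X][X]) (h : ∀ t, AuxNN (P t)) :
    AuxNN (∏ t ∈ s, P t) := by
  induction s using Finset.induction_on with
  | empty => simpa using AuxNN.one
  | insert a s ha ih => rw [Finset.prod_insert ha]; exact (h a).mul ih

lemma AuxNN.mul_coeff_ge {P Q : ℝ[X][X]} (hP : AuxNN P) (hQ : AuxNN Q) (u₁ v₁ u₂ v₂ : ℕ) :
    (P.coeff u₁).coeff v₁ * (Q.coeff u₂).coeff v₂ ≤ ((P * Q).coeff (u₁ + u₂)).coeff (v₁ + v₂) := by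
  rw [aux_coeff_mul]
  have hnn : ∀ x y : ℕ × ℕ, 0 ≤ (P.coeff x.1).coeff y.1 * (Q.coeff x.2).coeff y.2 :=
    fun x y => mul_nonneg (hP _ _) (hQ _ _)
  refine le_trans ?_ (Finset.single_le_sum (f := fun x : ℕ × ℕ => ∑ y ∈ antidiagonal (v₁ + v₂),
      (P.coeff x.1).coeff y.1 * (Q.coeff x.2).coeff y.2)
      (fun x _ => Finset.sum_nonneg fun y _ => hnn x y)
      (show ((u₁, u₂) : ℕ × ℕ) ∈ antidiagonal (u₁ + u₂) by simp))
  exact Finset.single_le_sum (f := fun y : ℕ × ℕ => (P.coeff u₁).coeff y.1 * (Q.coeff u₂).coeff y.2)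
      (fun y _ => hnn (u₁, u₂) y)
      (show ((v₁, v₂) : ℕ × ℕ) ∈ antidiagonal (v₁ + v₂) by simp)

lemma AuxNN.pow_coeff_ge {P : ℝ[X][X]} (hP : AuxNN P) (u v k : ℕ) :
    ((P.coeff u).coeff v) ^ k ≤ ((P ^ k).coeff (k * u)).coeff (k * v) := by
  induction k with
  | zero => simp
  | succ k ih =>
    rw [pow_succ, pow_succ, Nat.succ_mul, Nat.succ_mul]
    exact le_trans (mul_le_mul_of_nonneg_right ih (hP u v)) ((hP.pow k).mul_coeff_ge hP _ _ _ _)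

lemma aux_uni_le_eval (p : ℝ[X]) (hp : ∀ v, 0 ≤ p.coeff v) (y : ℝ) (hy : 0 ≤ y) (v : ℕ) :
    p.coeff v * y ^ v ≤ p.eval y := by
  by_cases hv : v ≤ p.natDegree
  · rw [eval_eq_sum_range]
    exact Finset.single_le_sum (f := fun v => p.coeff v * y ^ v)
      (fun v _ => mul_nonneg (hp v) (pow_nonneg hy v)) (Finset.mem_range.2 (Nat.lt_succ_of_le hv))
  · rw [coeff_eq_zero_of_natDegree_lt (not_le.1 hv), zero_mul, eval_eq_sum_range]
    exact Finset.sum_nonneg fun v _ => mul_nonneg (hp v) (pow_nonneg hy v)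

lemma AuxNN.le_evalEval {P : ℝ[X][X]} (hP : AuxNN P) (x y : ℝ) (hx : 0 ≤ x) (hy : 0 ≤ y) (u v : ℕ) :
    (P.coeff u).coeff v * (x ^ u * y ^ v) ≤ P.evalEval y x := by
  have hu : ∀ u, (P.coeff u).coeff v * y ^ v ≤ (P.coeff u).eval y :=
    fun u => aux_uni_le_eval _ (hP u) y hy v
  have hu0 : ∀ u, 0 ≤ (P.coeff u).eval y :=
    fun u => le_trans (mul_nonneg (hP u v) (pow_nonneg hy v)) (hu u)
  have he : P.evalEval y x = ∑ u ∈ range (P.natDegree + 1), (P.coeff u).eval y * x ^ u := by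
    rw [evalEval, eval_eq_sum_range (p := P), eval_finsetSum]
    simp
  rw [he]
  by_cases h : u ≤ P.natDegree
  · refine le_trans ?_ (Finset.single_le_sum (f := fun u => (P.coeff u).eval y * x ^ u)
      (fun u _ => mul_nonneg (hu0 u) (pow_nonneg hx u)) (Finset.mem_range.2 (Nat.lt_succ_of_le h)))
    have := mul_le_mul_of_nonneg_right (hu u) (pow_nonneg hx u)
    calc _ = (P.coeff u).coeff v * y ^ v * x ^ u := by ring
      _ ≤ _ := this
  · rw [coeff_eq_zero_of_natDegree_lt (not_le.1 h), coeff_zero, zero_mul]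
    exact Finset.sum_nonneg fun u _ => mul_nonneg (hu0 u) (pow_nonneg hx u)

/-- support condition -/
def AuxSupp (a b : ℕ) (P : ℝ[X][X]) : Prop :=
  ∀ u v, (P.coeff u).coeff v ≠ 0 → v ≤ a * u ∧ u ≤ b * v

lemma AuxSupp.one (a b : ℕ) : AuxSupp a b 1 := by
  intro u v h
  rw [coeff_one] at h
  split_ifs at h with h1
  · rw [coeff_one] at h
    split_ifs at h with h2
    · subst h1; subst h2; simp
    · simp at h
  · simp at h

lemma AuxSupp.mul {a b : ℕ} {P Q : ℝ[X][X]} (hP : AuxSupp a b P) (hQ : AuxSupp a b Q) :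
    AuxSupp a b (P * Q) := by
  intro u v h
  rw [aux_coeff_mul] at h
  obtain ⟨x, hx, hx2⟩ := Finset.exists_ne_zero_of_sum_ne_zero h
  obtain ⟨y, hy, hy2⟩ := Finset.exists_ne_zero_of_sum_ne_zero hx2
  rw [HasAntidiagonal.mem_antidiagonal] at hx hy
  have h1 := hP _ _ (left_ne_zero_of_mul hy2)
  have h2 := hQ _ _ (right_ne_zero_of_mul hy2)
  rw [← hx, ← hy, mul_add, mul_add]
  omega

lemma AuxSupp.pow {a b : ℕ} {P : ℝ[X][X]} (hP : AuxSupp a b P) (n : ℕ) : AuxSupp a b (P ^ n) := by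
  induction n with
  | zero => simpa using AuxSupp.one a b
  | succ n ih => rw [pow_succ]; exact ih.mul hP

lemma AuxSupp.prod {a b : ℕ} {ι : Type*} (s : Finset ι) (P : ι → ℝ[X][X])
    (h : ∀ t, AuxSupp a b (P t)) : AuxSupp a b (∏ t ∈ s, P t) := by
  induction s using Finset.induction_on with
  | empty => simpa using AuxSupp.one a b
  | insert t s ha ih => rw [Finset.prod_insert ha]; exact (h t).mul ih

/-- domination of an exponential -/
def AuxDom (i j k : ℕ) (c : ℝ) (P : ℝ[X][X]) : Prop :=
  ∀ m ≤ k, c ^ m / (m.factorial : ℝ) ≤ (P.coeff (m * i)).coeff (m * j)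

lemma AuxDom.one (i j k : ℕ) : AuxDom i j k 0 1 := by
  intro m _
  rcases Nat.eq_zero_or_pos m with rfl | hm
  · simp
  · rw [zero_pow hm.ne', zero_div]; exact AuxNN.one _ _

lemma AuxDom.mul {i j k : ℕ} (hi : 0 < i) {c d : ℝ} {P Q : ℝ[X][X]}
    (hc : 0 ≤ c) (hd : 0 ≤ d)
    (hP : AuxNN P) (hQ : AuxNN Q) (h1 : AuxDom i j k c P) (h2 : AuxDom i j k d Q) :
    AuxDom i j k (c + d) (P * Q) := by
  intro m hm
  rw [aux_coeff_mul]
  have hnn : ∀ x y : ℕ × ℕ, 0 ≤ (P.coeff x.1).coeff y.1 * (Q.coeff x.2).coeff y.2 :=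
    fun x y => mul_nonneg (hP _ _) (hQ _ _)
  have hexp : (c + d) ^ m / (m.factorial : ℝ) = ∑ x ∈ antidiagonal m,
      (c ^ x.1 / (x.1.factorial : ℝ)) * (d ^ x.2 / (x.2.factorial : ℝ)) := by
    rw [(Commute.all c d).add_pow', Finset.sum_div]
    refine Finset.sum_congr rfl fun x hx => ?_
    rw [HasAntidiagonal.mem_antidiagonal] at hx
    have h4 : (m.choose x.1 * x.1.factorial * x.2.factorial : ℝ) = (m.factorial : ℝ) := by
      have := Nat.choose_mul_factorial_mul_factorial (show x.1 ≤ m by omega)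
      rw [show m - x.1 = x.2 by omega] at this
      exact_mod_cast this
    have a1 : (x.1.factorial : ℝ) ≠ 0 := by exact_mod_cast x.1.factorial_ne_zero
    have a2 : (x.2.factorial : ℝ) ≠ 0 := by exact_mod_cast x.2.factorial_ne_zero
    have a3 : (m.factorial : ℝ) ≠ 0 := by exact_mod_cast m.factorial_ne_zero
    rw [nsmul_eq_mul, div_mul_div_comm, div_eq_div_iff a3 (mul_ne_zero a1 a2), ← h4]
    ring
  rw [hexp]
  calc _ ≤ ∑ x ∈ antidiagonal m, ∑ y ∈ antidiagonal (m * j),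
        (P.coeff (x.1 * i)).coeff y.1 * (Q.coeff (x.2 * i)).coeff y.2 := by
        refine Finset.sum_le_sum fun x hx => ?_
        rw [HasAntidiagonal.mem_antidiagonal] at hx
        refine le_trans ?_ (Finset.single_le_sum
          (f := fun y : ℕ × ℕ => (P.coeff (x.1 * i)).coeff y.1 * (Q.coeff (x.2 * i)).coeff y.2)
          (fun y _ => hnn (x.1 * i, x.2 * i) y)
          (show ((x.1 * j, x.2 * j) : ℕ × ℕ) ∈ antidiagonal (m * j) by
            rw [HasAntidiagonal.mem_antidiagonal, ← hx]; ring))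
        have b1 := h1 x.1 (by omega)
        have b2 := h2 x.2 (by omega)
        exact mul_le_mul b1 b2 (by positivity) (hP _ _)
    _ = ∑ x ∈ (antidiagonal m).image (fun x => (x.1 * i, x.2 * i)), ∑ y ∈ antidiagonal (m * j),
        (P.coeff x.1).coeff y.1 * (Q.coeff x.2).coeff y.2 := by
        rw [Finset.sum_image]
        rintro ⟨a, b⟩ _ ⟨a', b'⟩ _ h
        simp only [Prod.mk.injEq] at h ⊢
        exact ⟨Nat.eq_of_mul_eq_mul_right hi h.1, Nat.eq_of_mul_eq_mul_right hi h.2⟩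
    _ ≤ _ := by
        refine Finset.sum_le_sum_of_subset_of_nonneg ?_ ?_
        · intro x hx
          simp only [Finset.mem_image, HasAntidiagonal.mem_antidiagonal] at hx ⊢
          obtain ⟨a, ha, rfl⟩ := hx
          rw [← ha]; ring
        · intro x _ _
          exact Finset.sum_nonneg fun y _ => hnn x y

lemma AuxDom.pow {i j k N : ℕ} (hi : 0 < i) {b : ℝ} {P : ℝ[X][X]} (hb : 0 ≤ b)
    (hP : AuxNN P) (h0 : 1 ≤ (P.coeff 0).coeff 0) (h1 : b ≤ (P.coeff i).coeff j) (hk : k ≤ N) :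
    AuxDom i j k (b * ((N:ℝ) - k)) (P ^ N) := by
  have key : ∀ N m : ℕ, (N.choose m : ℝ) * b ^ m ≤ ((P ^ N).coeff (m * i)).coeff (m * j) := by
    intro N
    induction N with
    | zero =>
      intro m
      cases m with
      | zero => simp
      | succ m => simpa using AuxNN.one _ _
    | succ N ih =>
      intro m
      rw [pow_succ]
      cases m with
      | zero =>
        have := (hP.pow N).mul_coeff_ge hP 0 0 0 0
        have h2 := ih 0
        simp only [Nat.choose_zero_right, Nat.cast_one, pow_zero, mul_one, zero_mul] at h2 ⊢
        refine le_trans ?_ this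
        nlinarith
      | succ m =>
        rw [aux_coeff_mul]
        have hnn : ∀ x y : ℕ × ℕ, 0 ≤ ((P ^ N).coeff x.1).coeff y.1 * (P.coeff x.2).coeff y.2 :=
          fun x y => mul_nonneg (hP.pow N _ _) (hP _ _)
        have s1 : ∑ x ∈ ({((m+1)*i, 0), (m*i, i)} : Finset (ℕ × ℕ)),
            ∑ y ∈ antidiagonal ((m+1) * j), ((P ^ N).coeff x.1).coeff y.1 * (P.coeff x.2).coeff y.2
            ≤ ∑ x ∈ antidiagonal ((m+1) * i),
            ∑ y ∈ antidiagonal ((m+1) * j), ((P ^ N).coeff x.1).coeff y.1 * (P.coeff x.2).coeff y.2 := by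
          refine Finset.sum_le_sum_of_subset_of_nonneg ?_ ?_
          · intro x hx
            simp only [Finset.mem_insert, Finset.mem_singleton] at hx
            rw [HasAntidiagonal.mem_antidiagonal]
            rcases hx with rfl | rfl
            · simp
            · simp only; ring
          · intro x _ _
            exact Finset.sum_nonneg fun y _ => hnn x y
        refine le_trans ?_ s1
        rw [Finset.sum_pair (by simp only [ne_eq, Prod.mk.injEq, not_and]; intro _; omega)]
        have t1 := Finset.single_le_sum
          (f := fun y : ℕ × ℕ => ((P ^ N).coeff ((m+1)*i)).coeff y.1 * (P.coeff 0).coeff y.2)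
          (fun y _ => hnn ((m+1)*i, 0) y)
          (show (((m+1) * j, 0) : ℕ × ℕ) ∈ antidiagonal ((m+1) * j) by simp)
        have t2 := Finset.single_le_sum
          (f := fun y : ℕ × ℕ => ((P ^ N).coeff (m*i)).coeff y.1 * (P.coeff i).coeff y.2)
          (fun y _ => hnn (m*i, i) y)
          (show ((m * j, j) : ℕ × ℕ) ∈ antidiagonal ((m+1) * j) by rw [HasAntidiagonal.mem_antidiagonal]; ring)
        refine le_trans ?_ (add_le_add t1 t2)
        have i1 := ih (m+1)
        have i2 := ih m
        have j1 : ((P ^ N).coeff ((m+1)*i)).coeff ((m+1)*j) * 1 ≤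
          ((P ^ N).coeff ((m+1)*i)).coeff ((m+1)*j) * (P.coeff 0).coeff 0 :=
          mul_le_mul_of_nonneg_left h0 (hP.pow N _ _)
        have j2 : (N.choose m : ℝ) * b ^ m * b ≤
          ((P ^ N).coeff (m*i)).coeff (m*j) * (P.coeff i).coeff j :=
          mul_le_mul i2 h1 hb (hP.pow N _ _)
        rw [Nat.choose_succ_succ]
        push_cast
        rw [pow_succ] at i1 ⊢
        nlinarith
  intro m hm
  refine le_trans ?_ (key N m)
  have h2 : ((N + 1 - m : ℕ) ^ m : ℝ) / (m.factorial : ℝ) ≤ N.choose m := Nat.pow_le_choose m N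
  have h3 : ((N:ℝ) - k) ≤ ((N + 1 - m : ℕ) : ℝ) := by
    rw [Nat.cast_sub (by omega)]
    push_cast
    have : (m:ℝ) ≤ k := by exact_mod_cast hm
    linarith
  have h4 : (0:ℝ) ≤ (N:ℝ) - k := by
    have : (k:ℝ) ≤ N := by exact_mod_cast hk
    linarith
  rw [mul_pow]
  calc b ^ m * ((N:ℝ) - k) ^ m / (m.factorial : ℝ)
      = ((N:ℝ) - k) ^ m / (m.factorial : ℝ) * b ^ m := by ring
    _ ≤ ((N + 1 - m : ℕ) : ℝ) ^ m / (m.factorial : ℝ) * b ^ m := by gcongr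
    _ ≤ _ := by gcongr

lemma AuxDom.prod {ι : Type*} (s : Finset ι) {i j k : ℕ} (hi : 0 < i) (N : ι → ℕ) (b : ι → ℝ)
    (P : ι → ℝ[X][X]) (hb : ∀ t, 0 ≤ b t)
    (hP : ∀ t, AuxNN (P t)) (h0 : ∀ t, 1 ≤ ((P t).coeff 0).coeff 0)
    (h1 : ∀ t, b t ≤ ((P t).coeff i).coeff j) (hk : ∀ t, k ≤ N t) :
    AuxDom i j k (∑ t ∈ s, b t * ((N t : ℝ) - k)) (∏ t ∈ s, P t ^ N t) := by
  have hpos : ∀ t, 0 ≤ b t * ((N t : ℝ) - k) := fun t => mul_nonneg (hb t) (by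
    have : (k:ℝ) ≤ N t := by exact_mod_cast hk t
    linarith)
  induction s using Finset.induction_on with
  | empty => simpa using AuxDom.one i j k
  | insert t s ha ih =>
    rw [Finset.prod_insert ha, Finset.sum_insert ha]
    exact AuxDom.mul hi (hpos t) (Finset.sum_nonneg fun t _ => hpos t) ((hP t).pow _)
      (AuxNN.prod s _ fun t => (hP t).pow _)
      (AuxDom.pow hi (hb t) (hP t) (h0 t) (h1 t) (hk t)) ih

namespace DGLDPC
variable (M : DGLDPC)

lemma aux_Bcoeff (t : Fin M.nv) (u v : ℕ) : ((M.Bpoly t).coeff u).coeff v = (M.B t u v : ℝ) := by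
  have hz : ∀ u v, ¬ (u < M.kdim t + 1 ∧ v < M.q t + 1) → M.B t u v = 0 := by
    intro u v h
    apply M.hBsupp
    · rintro ⟨rfl, rfl⟩; exact h ⟨by omega, by omega⟩
    · rintro ⟨_, h2, _, h4⟩; exact h ⟨by omega, by omega⟩
  have hc : (M.Bpoly t).coeff u = if u ∈ Finset.range (M.kdim t + 1) then
      (∑ v ∈ Finset.range (M.q t + 1), Polynomial.C ((M.B t u v : ℕ) : ℝ) * Polynomial.X ^ v)
      else 0 := by
    unfold Bpoly
    rw [finsetSum_coeff]
    simp only [coeff_C_mul, coeff_X_pow, mul_ite, mul_one, mul_zero]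
    rw [Finset.sum_ite_eq]
  rw [hc]
  split_ifs with h1
  · simp only [finsetSum_coeff, coeff_C_mul, coeff_X_pow, mul_ite, mul_one, mul_zero]
    rw [Finset.sum_ite_eq]
    split_ifs with h2
    · rfl
    · rw [hz u v (by simp at h2; omega)]; simp
  · rw [hz u v (by simp at h1; omega)]; simp

lemma aux_Acoeff (t : Fin M.nc) (v : ℕ) : (M.Apoly t).coeff v = (M.A t v : ℝ) := by
  unfold Apoly
  simp only [finsetSum_coeff, coeff_C_mul, coeff_X_pow, mul_ite, mul_one, mul_zero]
  rw [Finset.sum_ite_eq]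
  split_ifs with h1
  · rfl
  · rw [M.hAsupp t v (by rintro rfl; simp at h1) (by simp at h1; omega)]; simp

lemma aux_Acoeff' (t : Fin M.nc) (u v : ℕ) :
    (((M.Apoly t).map Polynomial.C).coeff u).coeff v = if v = 0 then (M.A t u : ℝ) else 0 := by
  rw [coeff_map, coeff_C, aux_Acoeff]

lemma aux_BNN (t : Fin M.nv) : AuxNN (M.Bpoly t) := by
  intro u v; rw [aux_Bcoeff]; positivity

lemma aux_ANN (t : Fin M.nc) : AuxNN ((M.Apoly t).map Polynomial.C) := by
  intro u v; rw [aux_Acoeff']; split_ifs <;> positivity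

lemma aux_Bsupp_prop (t : Fin M.nv) (u v : ℕ) (h : M.B t u v ≠ 0) (h0 : (u, v) ≠ (0, 0)) :
    1 ≤ u ∧ u ≤ M.kdim t ∧ M.pd t ≤ v ∧ v ≤ M.q t := by
  by_contra hc
  exact h (M.hBsupp t u v (by rintro ⟨rfl, rfl⟩; exact h0 rfl) hc)

lemma aux_Bsupp (t : Fin M.nv) : AuxSupp (∑ t, M.q t) (∑ t, M.kdim t) (M.Bpoly t) := by
  intro u v h
  rw [aux_Bcoeff] at h
  have h' : M.B t u v ≠ 0 := by exact_mod_cast h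
  by_cases h0 : (u, v) = (0, 0)
  · simp only [Prod.mk.injEq] at h0; rw [h0.1, h0.2]; simp
  have h1 := M.aux_Bsupp_prop t u v h' h0
  have hq : M.q t ≤ ∑ t, M.q t := Finset.single_le_sum (f := M.q) (fun _ _ => Nat.zero_le _) (Finset.mem_univ t)
  have hk : M.kdim t ≤ ∑ t, M.kdim t := Finset.single_le_sum (f := M.kdim) (fun _ _ => Nat.zero_le _) (Finset.mem_univ t)
  have hp := M.h_pd2 t
  constructor
  · calc v ≤ (∑ t, M.q t) * 1 := by omega
      _ ≤ _ := Nat.mul_le_mul_left _ h1.1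
  · calc u ≤ (∑ t, M.kdim t) * 1 := by omega
      _ ≤ _ := Nat.mul_le_mul_left _ (by omega)

noncomputable def auxVP (n : ℕ) : ℝ[X][X] := ∏ t, M.Bpoly t ^ M.vExp n t
noncomputable def auxCP (n : ℕ) : ℝ[X][X] := ∏ t, ((M.Apoly t).map Polynomial.C) ^ M.cExp n t

lemma aux_Nv (n u v : ℕ) : M.NvCount n u v = ((M.auxVP n).coeff u).coeff v := rfl
lemma aux_Nc (n v : ℕ) : M.NcCount n v = ((M.auxCP n).coeff v).coeff 0 := by
  have : M.auxCP n = (∏ t, M.Apoly t ^ M.cExp n t).map Polynomial.C := by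
    unfold auxCP
    rw [Polynomial.map_prod]
    simp [Polynomial.map_pow]
  rw [this, coeff_map, coeff_C_zero]; rfl

lemma aux_VNN (n : ℕ) : AuxNN (M.auxVP n) := AuxNN.prod _ _ fun t => (M.aux_BNN t).pow _
lemma aux_CNN (n : ℕ) : AuxNN (M.auxCP n) := AuxNN.prod _ _ fun t => (M.aux_ANN t).pow _

lemma aux_Nv_nonneg (n u v : ℕ) : 0 ≤ M.NvCount n u v := M.aux_VNN n u v
lemma aux_Nc_nonneg (n v : ℕ) : 0 ≤ M.NcCount n v := by rw [aux_Nc]; exact M.aux_CNN n v 0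

lemma aux_term_nonneg (n w v : ℕ) :
    0 ≤ M.NvCount n w v * M.NcCount n v / ((M.En n).choose v : ℝ) :=
  div_nonneg (mul_nonneg (M.aux_Nv_nonneg _ _ _) (M.aux_Nc_nonneg _ _)) (by positivity)

lemma aux_term_le (n w v : ℕ) (hv : v ≤ M.En n) :
    M.NvCount n w v * M.NcCount n v / ((M.En n).choose v : ℝ) ≤ M.ENw n w :=
  Finset.single_le_sum (f := fun v => M.NvCount n w v * M.NcCount n v / ((M.En n).choose v : ℝ))
    (fun v _ => M.aux_term_nonneg n w v) (Finset.mem_range.2 (Nat.lt_succ_of_le hv))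

lemma aux_exists_term (n w : ℕ) : ∃ v ≤ M.En n,
    M.ENw n w ≤ ((M.En n : ℝ) + 1) * (M.NvCount n w v * M.NcCount n v / ((M.En n).choose v : ℝ)) := by
  have h : ∑ v ∈ Finset.range (M.En n + 1), M.ENw n w / ((M.En n : ℝ) + 1) ≤
      ∑ v ∈ Finset.range (M.En n + 1),
        M.NvCount n w v * M.NcCount n v / ((M.En n).choose v : ℝ) := by
    rw [Finset.sum_const, Finset.card_range, nsmul_eq_mul]
    push_cast
    have : ((M.En n : ℝ) + 1) * (M.ENw n w / ((M.En n : ℝ) + 1)) = M.ENw n w := by field_simp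
    rw [this]; rfl
  obtain ⟨v, hv, hle⟩ := Finset.exists_le_of_sum_le ⟨0, by simp⟩ h
  refine ⟨v, by simpa [Nat.lt_succ_iff] using hv, ?_⟩
  rw [div_le_iff₀ (by positivity)] at hle
  linarith

lemma aux_intlam_pos : 0 < M.intlam := by
  unfold intlam
  have : Nonempty (Fin M.nv) := ⟨⟨0, M.hnv⟩⟩
  refine Finset.sum_pos (fun t _ => ?_) Finset.univ_nonempty
  have := M.h_q1 t
  have := M.hlampos t
  have : (0:ℝ) < M.q t := by exact_mod_cast M.h_q1 t
  positivity

/-- integrality -/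
def auxInt (α : ℝ) (n : ℕ) : Prop :=
  0 < n ∧ ((M.En n : ℝ) = (n : ℝ) / M.intlam) ∧
  (∀ t, (M.cExp n t : ℝ) = (M.En n : ℝ) * M.ρ t / (M.s t : ℝ)) ∧
  (∀ t, (M.vExp n t : ℝ) = (M.En n : ℝ) * M.lam t / (M.q t : ℝ)) ∧
  ((⌊α * (n : ℝ)⌋₊ : ℝ) = α * (n : ℝ))

variable {M}

lemma Adm.toInt {α : ℝ} {n : ℕ} (h : M.Adm α n) : M.auxInt α n :=
  ⟨h.1, h.2.1, h.2.2.1, h.2.2.2.1, h.2.2.2.2.1⟩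

/-- combining -/
lemma auxInt.comb {α : ℝ} {n₀ n₁ : ℕ} (h₀ : M.auxInt α n₀) (h₁ : M.auxInt α n₁) (k : ℕ) :
    M.En (n₀ + k * n₁) = M.En n₀ + k * M.En n₁ ∧
    (∀ t, M.cExp (n₀ + k * n₁) t = M.cExp n₀ t + k * M.cExp n₁ t) ∧
    (∀ t, M.vExp (n₀ + k * n₁) t = M.vExp n₀ t + k * M.vExp n₁ t) ∧
    ⌊α * ((n₀ + k * n₁ : ℕ) : ℝ)⌋₊ = ⌊α * (n₀ : ℝ)⌋₊ + k * ⌊α * (n₁ : ℝ)⌋₊ ∧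
    M.auxInt α (n₀ + k * n₁) := by
  obtain ⟨a0, a1, a2, a3, a4⟩ := h₀
  obtain ⟨b0, b1, b2, b3, b4⟩ := h₁
  have hE : M.En (n₀ + k * n₁) = M.En n₀ + k * M.En n₁ := by
    have : ((n₀ + k * n₁ : ℕ) : ℝ) / M.intlam = ((M.En n₀ + k * M.En n₁ : ℕ) : ℝ) := by
      push_cast; rw [a1, b1]; ring
    rw [show M.En (n₀ + k * n₁) = ⌊((n₀ + k * n₁ : ℕ) : ℝ) / M.intlam⌋₊ from rfl, this, Nat.floor_natCast]
  have hc : ∀ t, M.cExp (n₀ + k * n₁) t = M.cExp n₀ t + k * M.cExp n₁ t := by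
    intro t
    have : ((M.En (n₀ + k * n₁) : ℕ) : ℝ) * M.ρ t / M.s t = ((M.cExp n₀ t + k * M.cExp n₁ t : ℕ) : ℝ) := by
      rw [hE]; push_cast; rw [a2, b2]; ring
    rw [show M.cExp (n₀ + k * n₁) t = ⌊((M.En (n₀ + k * n₁) : ℕ) : ℝ) * M.ρ t / M.s t⌋₊ from rfl, this, Nat.floor_natCast]
  have hv : ∀ t, M.vExp (n₀ + k * n₁) t = M.vExp n₀ t + k * M.vExp n₁ t := by
    intro t
    have : ((M.En (n₀ + k * n₁) : ℕ) : ℝ) * M.lam t / M.q t = ((M.vExp n₀ t + k * M.vExp n₁ t : ℕ) : ℝ) := by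
      rw [hE]; push_cast; rw [a3, b3]; ring
    rw [show M.vExp (n₀ + k * n₁) t = ⌊((M.En (n₀ + k * n₁) : ℕ) : ℝ) * M.lam t / M.q t⌋₊ from rfl, this, Nat.floor_natCast]
  have hw : ⌊α * ((n₀ + k * n₁ : ℕ) : ℝ)⌋₊ = ⌊α * (n₀ : ℝ)⌋₊ + k * ⌊α * (n₁ : ℝ)⌋₊ := by
    have : α * ((n₀ + k * n₁ : ℕ) : ℝ) = ((⌊α * (n₀ : ℝ)⌋₊ + k * ⌊α * (n₁ : ℝ)⌋₊ : ℕ) : ℝ) := by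
      push_cast; rw [a4, b4]; ring
    rw [this, Nat.floor_natCast]
  refine ⟨hE, hc, hv, hw, by omega, ?_, ?_, ?_, ?_⟩
  · rw [hE]; push_cast; rw [a1, b1]; ring
  · intro t; rw [hc, hE]; push_cast; rw [a2, b2]; ring
  · intro t; rw [hv, hE]; push_cast; rw [a3, b3]; ring
  · rw [hw]; push_cast; rw [a4, b4]; ring

lemma aux_En_pos {α : ℝ} {n : ℕ} (h : M.auxInt α n) : 1 ≤ M.En n := by
  have h1 : (0:ℝ) < M.En n := by
    rw [h.2.1]; have := M.aux_intlam_pos; have : (0:ℝ) < n := by exact_mod_cast h.1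
    positivity
  exact_mod_cast h1

variable (M)
noncomputable def auxc : ℝ := 3 * Real.log (1 / M.intlam + 1) + 2
variable {M}

lemma aux_logE {α : ℝ} {n : ℕ} (h : M.auxInt α n) :
    3 * Real.log ((M.En n : ℝ) + 1) + 2 ≤ 4 * Real.log n + M.auxc := by
  have hl := M.aux_intlam_pos
  have hn : (1:ℝ) ≤ n := by exact_mod_cast h.1
  have h1 : (M.En n : ℝ) + 1 ≤ n * (1 / M.intlam + 1) := by
    rw [h.2.1, mul_add, mul_one_div]; linarith
  have h2 := Real.log_le_log (by positivity) h1
  rw [Real.log_mul (by positivity) (by positivity)] at h2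
  have h3 := Real.log_nonneg hn
  unfold auxc; linarith

lemma aux_c_ge : 2 ≤ M.auxc := by
  have hl := M.aux_intlam_pos
  have : 0 ≤ Real.log (1 / M.intlam + 1) := Real.log_nonneg (by
    have : 0 < 1 / M.intlam := by positivity
    linarith)
  unfold auxc; linarith

lemma aux_sup {α : ℝ} {n₀ n₁ : ℕ} (h₁ : M.Adm α n₁) (h₀ : M.Adm α n₀) : ∃ κ : ℝ, ∀ k : ℕ,
    κ + k * (Real.log (M.ENw n₁ ⌊α * (n₁ : ℝ)⌋₊) - (4 * Real.log n₁ + M.auxc)) ≤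
      Real.log (M.ENw (n₀ + k * n₁) ⌊α * ((n₀ + k * n₁ : ℕ) : ℝ)⌋₊) := by
  have hI₁ := h₁.toInt
  have hI₀ := h₀.toInt
  obtain ⟨v₁, hv₁, ht₁⟩ := M.aux_exists_term n₁ ⌊α * (n₁ : ℝ)⌋₊
  obtain ⟨v₀, hv₀, ht₀⟩ := M.aux_exists_term n₀ ⌊α * (n₀ : ℝ)⌋₊
  have p₁ := h₁.2.2.2.2.2
  have p₀ := h₀.2.2.2.2.2
  set w₁ := ⌊α * (n₁ : ℝ)⌋₊
  set w₀ := ⌊α * (n₀ : ℝ)⌋₊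
  have hpos : ∀ n w v, 0 < M.ENw n w → M.ENw n w ≤ ((M.En n : ℝ) + 1) *
      (M.NvCount n w v * M.NcCount n v / ((M.En n).choose v : ℝ)) →
      0 < M.NvCount n w v ∧ 0 < M.NcCount n v := by
    intro n w v h1 h2
    constructor
    · rcases (M.aux_Nv_nonneg n w v).lt_or_eq with h | h
      · exact h
      · rw [← h] at h2; simp at h2; linarith
    · rcases (M.aux_Nc_nonneg n v).lt_or_eq with h | h
      · exact h
      · rw [← h] at h2; simp at h2; linarith
  obtain ⟨hV1, hC1⟩ := hpos _ _ _ p₁ ht₁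
  obtain ⟨hV0, hC0⟩ := hpos _ _ _ p₀ ht₀
  obtain ⟨x, hx, hxx⟩ := aux_choose_x (M.En n₁) v₁ (aux_En_pos hI₁) hv₁
  refine ⟨Real.log (M.NvCount n₀ w₀ v₀) + Real.log (M.NcCount n₀ v₀) -
    (M.En n₀ * Real.log (1 + x) - v₀ * Real.log x), ?_⟩
  intro k
  obtain ⟨hE, hc, hv, hw, hI⟩ := hI₀.comb hI₁ k
  rw [hw]
  set n := n₀ + k * n₁
  have hVP : M.auxVP n = M.auxVP n₀ * M.auxVP n₁ ^ k := by
    unfold auxVP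
    rw [← Finset.prod_pow, ← Finset.prod_mul_distrib]
    refine Finset.prod_congr rfl fun t _ => ?_
    rw [hv, pow_add, mul_comm k, pow_mul]
  have hCP : M.auxCP n = M.auxCP n₀ * M.auxCP n₁ ^ k := by
    unfold auxCP
    rw [← Finset.prod_pow, ← Finset.prod_mul_distrib]
    refine Finset.prod_congr rfl fun t _ => ?_
    rw [hc, pow_add, mul_comm k, pow_mul]
  have gV : M.NvCount n₀ w₀ v₀ * M.NvCount n₁ w₁ v₁ ^ k ≤ M.NvCount n (w₀ + k * w₁) (v₀ + k * v₁) := by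
    rw [aux_Nv, aux_Nv, aux_Nv, hVP]
    refine le_trans ?_ ((M.aux_VNN n₀).mul_coeff_ge ((M.aux_VNN n₁).pow k) _ _ _ _)
    exact mul_le_mul_of_nonneg_left ((M.aux_VNN n₁).pow_coeff_ge _ _ _) (M.aux_VNN n₀ _ _)
  have gC : M.NcCount n₀ v₀ * M.NcCount n₁ v₁ ^ k ≤ M.NcCount n (v₀ + k * v₁) := by
    rw [aux_Nc, aux_Nc, aux_Nc, hCP]
    refine le_trans ?_ ((M.aux_CNN n₀).mul_coeff_ge ((M.aux_CNN n₁).pow k) _ 0 _ (k * 0))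
    exact mul_le_mul_of_nonneg_left ((M.aux_CNN n₁).pow_coeff_ge _ _ _) (M.aux_CNN n₀ _ _)
  have hvle : v₀ + k * v₁ ≤ M.En n := by
    rw [hE]; exact add_le_add hv₀ (Nat.mul_le_mul_left k hv₁)
  have hch := aux_choose_le (M.En n) (v₀ + k * v₁) x hx hvle
  have hchp : (0:ℝ) < ((M.En n).choose (v₀ + k * v₁) : ℝ) := by exact_mod_cast Nat.choose_pos hvle
  have hch1 : (0:ℝ) < ((M.En n₁).choose v₁ : ℝ) := by exact_mod_cast Nat.choose_pos hv₁
  have lV := Real.log_le_log (by positivity) gV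
  have lC := Real.log_le_log (by positivity) gC
  rw [Real.log_mul (by positivity) (by positivity), Real.log_pow] at lV lC
  have PV : 0 < M.NvCount n (w₀ + k * w₁) (v₀ + k * v₁) := lt_of_lt_of_le (by positivity) gV
  have PC : 0 < M.NcCount n (v₀ + k * v₁) := lt_of_lt_of_le (by positivity) gC
  have lE := Real.log_le_log (by positivity) (M.aux_term_le n (w₀ + k * w₁) (v₀ + k * v₁) hvle)
  rw [Real.log_div (by positivity) (by positivity), Real.log_mul (by positivity) (by positivity)] at lE
  have l1 := Real.log_le_log p₁ ht₁
  rw [Real.log_mul (by positivity) (by positivity), Real.log_div (by positivity) (by positivity),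
    Real.log_mul (by positivity) (by positivity)] at l1
  have hlog := aux_logE hI₁
  have hE1 : (0:ℝ) < M.En n₁ := by exact_mod_cast aux_En_pos hI₁
  have hlE : Real.log (M.En n₁ : ℝ) ≤ Real.log ((M.En n₁ : ℝ) + 1) :=
    Real.log_le_log hE1 (by linarith)
  rw [hE] at hch
  push_cast at hch
  have hk : (0:ℝ) ≤ k := by positivity
  have fin : (k:ℝ) * (Real.log (M.ENw n₁ w₁) - (4 * Real.log n₁ + M.auxc)) ≤
      k * (Real.log (M.NvCount n₁ w₁ v₁) + Real.log (M.NcCount n₁ v₁) -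
        (M.En n₁ * Real.log (1 + x) - v₁ * Real.log x)) := by
    exact mul_le_mul_of_nonneg_left (by linarith) hk
  rw [← hE] at hch
  push_cast at hch
  nlinarith

end DGLDPC

lemma aux_log_one_sub (t : ℝ) (h0 : 0 ≤ t) (h1 : t ≤ 1 / 2) : -(2 * t) ≤ Real.log (1 - t) := by
  have h2 : (0:ℝ) < 1 - t := by linarith
  have h := Real.one_sub_inv_le_log_of_pos h2
  refine le_trans ?_ h
  have : (1 - t)⁻¹ ≤ 1 + 2 * t := by
    rw [inv_le_iff_one_le_mul₀ h2]; nlinarith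
  linarith

lemma aux_low (D Bs β X : ℝ) (n k : ℕ) (hD : 0 < D) (hB : 0 ≤ Bs) (hβ : 0 < β) (hn : 0 < n)
    (hk : 1 ≤ k) (hkn : (k:ℝ) = β * n) (hβB : β * Bs / D ≤ 1 / 2)
    (hX : (n * D - k * Bs) ^ k / (k.factorial : ℝ) ≤ X) :
    0 < X ∧ n * (β * (Real.log D - Real.log β + 1 - 2 * (β * Bs / D))) - Real.log k - 1 ≤ Real.log X := by
  have hn' : (0:ℝ) < n := by exact_mod_cast hn
  have hk' : (0:ℝ) < k := by exact_mod_cast hk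
  have hf : (0:ℝ) < (k.factorial : ℝ) := by exact_mod_cast k.factorial_pos
  have he : n * D - k * Bs = n * (D * (1 - β * Bs / D)) := by rw [hkn]; field_simp
  have h1 : 0 < 1 - β * Bs / D := by linarith
  rw [he] at hX
  have hp : 0 < (n * (D * (1 - β * Bs / D))) ^ k / (k.factorial : ℝ) := by positivity
  refine ⟨lt_of_lt_of_le hp hX, ?_⟩
  have h2 := Real.log_le_log hp hX
  rw [Real.log_div (by positivity) (by positivity), Real.log_pow, Real.log_mul (by positivity) (by positivity),
    Real.log_mul (by positivity) (by positivity)] at h2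
  have h3 := aux_log_one_sub _ (by positivity) hβB
  have h4 := aux_log_fact_le k hk
  have h5 : Real.log k = Real.log β + Real.log n := by
    rw [hkn, Real.log_mul (by positivity) (by positivity)]
  have h6 : (k:ℝ) * (-(2 * (β * Bs / D))) ≤ k * Real.log (1 - β * Bs / D) := by gcongr
  have h7 : (n:ℝ) * (β * (Real.log D - Real.log β + 1 - 2 * (β * Bs / D))) =
    k * (Real.log D - Real.log β + 1 - 2 * (β * Bs / D)) := by rw [hkn]; ring
  rw [h7]
  have h8 : (k:ℝ) * Real.log k = k * (Real.log β + Real.log n) := by rw [h5]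
  nlinarith

lemma aux_ev (c d : ℝ) (hd : 0 < d) : ∀ᶠ α : ℝ in nhdsWithin 0 (Set.Ioi 0), c * α ≤ d := by
  have : Tendsto (fun α : ℝ => c * α) (nhdsWithin 0 (Set.Ioi 0)) (nhds 0) := by
    have h : Tendsto (fun α : ℝ => c * α) (nhds 0) (nhds (c * 0)) :=
      (continuous_const.mul continuous_id).tendsto 0
    rw [mul_zero] at h
    exact h.mono_left nhdsWithin_le_nhds
  exact (this.eventually (gt_mem_nhds hd)).mono fun _ h => h.le

namespace DGLDPC
variable (M : DGLDPC)

lemma aux_r_le (t : Fin M.nc) : M.r ≤ M.rd t := Nat.sInf_le ⟨t, rfl⟩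
lemma aux_r_mem : ∃ t, M.rd t = M.r := Nat.sInf_mem (s := Set.range M.rd) ⟨_, ⟨⟨0, M.hnc⟩, rfl⟩⟩
lemma aux_r_ge : 2 ≤ M.r := by
  obtain ⟨t, ht⟩ := M.aux_r_mem; rw [← ht]; exact M.h_rd2 t

lemma aux_A_small (t : Fin M.nc) (u : ℕ) (h0 : u ≠ 0) (h : u < M.r) : M.A t u = 0 :=
  M.hAsupp t u h0 (Or.inl (lt_of_lt_of_le h (M.aux_r_le t)))

lemma aux_ψ_inv : M.ψ⁻¹ = 1 - 1 / (M.r : ℝ) := by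
  have h : (2:ℝ) ≤ M.r := by exact_mod_cast M.aux_r_ge
  unfold ψ
  rw [inv_div]; field_simp
lemma aux_ψ_pos : 0 < M.ψ := by
  have h : (2:ℝ) ≤ M.r := by exact_mod_cast M.aux_r_ge
  unfold ψ
  exact div_pos (by linarith) (by linarith)
lemma aux_ψ_le : M.ψ ≤ 2 := by
  have h : (2:ℝ) ≤ M.r := by exact_mod_cast M.aux_r_ge
  unfold ψ
  rw [div_le_iff₀ (by linarith)]; linarith

lemma aux_s_pos (t : Fin M.nc) : (0:ℝ) < M.s t := by
  have := M.h_hs t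
  exact_mod_cast (by omega : 0 < M.s t)
lemma aux_q_pos (t : Fin M.nv) : (0:ℝ) < M.q t := by exact_mod_cast M.h_q1 t

lemma aux_C_eq : M.Cparam = M.r * ∑ t, M.ρ t * (M.A t M.r : ℝ) / (M.s t : ℝ) := by
  unfold Cparam
  congr 1
  rw [Finset.sum_filter]
  refine Finset.sum_congr rfl fun t _ => ?_
  split_ifs with h
  · rfl
  · have h1 := M.aux_r_le t
    have h2 := M.aux_r_ge
    rw [M.hAsupp t M.r (by omega) (Or.inl (by omega))]; simp

lemma aux_C_pos : 0 < M.Cparam := by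
  rw [aux_C_eq]
  have h : (2:ℝ) ≤ M.r := by exact_mod_cast M.aux_r_ge
  refine mul_pos (by linarith) ?_
  obtain ⟨t, ht⟩ := M.aux_r_mem
  have hnn : ∀ t, 0 ≤ M.ρ t * (M.A t M.r : ℝ) / (M.s t : ℝ) := fun t => by
    have := M.hρpos t; positivity
  refine Finset.sum_pos' (fun t _ => hnn t) ⟨t, Finset.mem_univ t, ?_⟩
  have h1 : (0:ℝ) < M.A t M.r := by rw [← ht]; exact_mod_cast M.hAr t
  have := M.hρpos t; have := M.aux_s_pos t
  positivity

lemma aux_δ_pos (t : Fin M.nv) : 0 < M.δfrac t := by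
  have := M.hlampos t; have := M.aux_q_pos t; have := M.aux_intlam_pos
  unfold δfrac; positivity

lemma aux_S_prop {i j : ℕ} (h : (i, j) ∈ M.Sminus) : 1 ≤ i ∧ 2 ≤ j := by
  obtain ⟨⟨t, ht⟩, h0⟩ := h
  have := M.aux_Bsupp_prop t i j ht.ne' h0
  have := M.h_pd2 t
  omega

noncomputable def auxD (i j : ℕ) : ℝ := ∑ t, (M.B t i j : ℝ) * M.δfrac t

lemma aux_D_nonneg (i j : ℕ) : 0 ≤ M.auxD i j :=
  Finset.sum_nonneg fun t _ => mul_nonneg (by positivity) (M.aux_δ_pos t).le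

lemma aux_D_pos {i j : ℕ} (h : (i, j) ∈ M.Sminus) : 0 < M.auxD i j := by
  obtain ⟨⟨t, ht⟩, h0⟩ := h
  refine Finset.sum_pos' (fun t _ => mul_nonneg (by positivity) (M.aux_δ_pos t).le) ⟨t, Finset.mem_univ t, ?_⟩
  have : (0:ℝ) < M.B t i j := by exact_mod_cast ht
  exact mul_pos this (M.aux_δ_pos t)

noncomputable def auxMain (i j : ℕ) (α : ℝ) : ℝ := (M.T / M.ψ) * α * Real.log α +
              ((1 / (i : ℝ)) *
                  (Real.log ((i : ℝ) * ∑ t, (M.B t i j : ℝ) * M.δfrac t) +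
                    ((j : ℝ) / (M.r : ℝ)) * Real.log M.Cparam +
                    ((j : ℝ) / M.ψ) * Real.log ((j : ℝ) * M.intlam / (i : ℝ))) -
                M.T / M.ψ) * α

lemma aux_main_eq {i j : ℕ} (hmem : (i, j) ∈ M.Sminus) (hT : M.Tij i j = M.T) {α : ℝ} (hα : 0 < α) :
    M.auxMain i j α = α / i * (1 - Real.log α + Real.log (i * M.auxD i j)) +
      j * α / i * (1 / M.r * Real.log M.Cparam + 1 / M.ψ * (Real.log (j * α * M.intlam / i) - 1)) := by
  obtain ⟨hi, hj⟩ := M.aux_S_prop hmem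
  have hi' : (0:ℝ) < i := by exact_mod_cast hi
  have hj' : (0:ℝ) < j := by exact_mod_cast (by omega : 0 < j)
  have hl := M.aux_intlam_pos
  have hψ := M.aux_ψ_pos
  have hr : (0:ℝ) < M.r := by exact_mod_cast (by have := M.aux_r_ge; omega : 0 < M.r)
  have e : (j:ℝ) * α * M.intlam / i = α * (j * M.intlam / i) := by ring
  rw [e, Real.log_mul hα.ne' (by positivity)]
  unfold auxMain
  rw [← hT]
  unfold Tij
  change _ * _ * _ + (_ * (Real.log (i * M.auxD i j) + _ + _) - _) * _ = _
  field_simp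
  ring

lemma aux_alg (α i j r li lα lD lC lj ll lr : ℝ) (hi : i ≠ 0) (hr : r ≠ 0) :
    α / i * (1 - lα + (li + lD)) + j * α / i * (1 / r * lC + (1 - 1 / r) * (lj + lα + ll - li - 1)) =
    1 / i * α * (lD - (0 - li + lα) + 1) +
      j / (i * r) * α * (lC - (lr + ll) - (lj - (li + lr) + lα) + 1) -
      j / i * α * (-ll - (lj - li + lα) + 1) := by
  field_simp
  ring

lemma aux_main_eq2 {i j : ℕ} (hmem : (i, j) ∈ M.Sminus) (hT : M.Tij i j = M.T) {α : ℝ} (hα : 0 < α) :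
    M.auxMain i j α = (1 / i * α) * (Real.log (M.auxD i j) - Real.log (1 / i * α) + 1) +
      (j / (i * M.r) * α) * (Real.log (M.Cparam / (M.r * M.intlam)) - Real.log (j / (i * M.r) * α) + 1) -
      (j / i * α) * (- Real.log M.intlam - Real.log (j / i * α) + 1) := by
  obtain ⟨hi, hj⟩ := M.aux_S_prop hmem
  have hi' : (0:ℝ) < i := by exact_mod_cast hi
  have hj' : (0:ℝ) < j := by exact_mod_cast (by omega : 0 < j)
  have hl := M.aux_intlam_pos
  have hr : (0:ℝ) < M.r := by exact_mod_cast (by have := M.aux_r_ge; omega : 0 < M.r)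
  have hC := M.aux_C_pos
  have hD := M.aux_D_pos hmem
  have e1 : Real.log (i * M.auxD i j) = Real.log i + Real.log (M.auxD i j) := Real.log_mul hi'.ne' hD.ne'
  have e2 : Real.log (1 / i * α) = 0 - Real.log i + Real.log α := by
    rw [Real.log_mul (by positivity) hα.ne', Real.log_div one_ne_zero hi'.ne', Real.log_one]
  have e3 : Real.log (M.Cparam / (M.r * M.intlam)) = Real.log M.Cparam - (Real.log M.r + Real.log M.intlam) := by
    rw [Real.log_div hC.ne' (by positivity), Real.log_mul hr.ne' hl.ne']
  have e4 : Real.log (j / (i * M.r) * α) = Real.log j - (Real.log i + Real.log M.r) + Real.log α := by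
    rw [Real.log_mul (by positivity) hα.ne', Real.log_div hj'.ne' (by positivity), Real.log_mul hi'.ne' hr.ne']
  have e5 : Real.log (j / i * α) = Real.log j - Real.log i + Real.log α := by
    rw [Real.log_mul (by positivity) hα.ne', Real.log_div hj'.ne' hi'.ne']
  have e6 : Real.log (j * α * M.intlam / i) = Real.log j + Real.log α + Real.log M.intlam - Real.log i := by
    rw [Real.log_div (by positivity) hi'.ne', Real.log_mul (by positivity) hl.ne', Real.log_mul hj'.ne' hα.ne']
  rw [M.aux_main_eq hmem hT hα, show (1:ℝ) / M.ψ = M.ψ⁻¹ by rw [one_div], aux_ψ_inv, e1, e2, e3, e4, e5, e6]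
  exact aux_alg _ _ _ _ _ _ _ _ _ _ _ hi'.ne' hr.ne'

set_option maxHeartbeats 1000000 in
theorem aux_lower {i j : ℕ} (hmem : (i, j) ∈ M.Sminus) (hT : M.Tij i j = M.T) :
    ∃ K : ℝ, 0 ≤ K ∧ ∀ᶠ α : ℝ in nhdsWithin 0 (Set.Ioi 0), ∀ n κ : ℕ, M.auxInt α n →
      ⌊α * (n:ℝ)⌋₊ = i * M.r * κ → 1 ≤ κ →
      0 < M.ENw n ⌊α * (n:ℝ)⌋₊ ∧
      n * (M.auxMain i j α - K * α ^ 2) - (4 * Real.log n + M.auxc) ≤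
        Real.log (M.ENw n ⌊α * (n:ℝ)⌋₊) := by
  obtain ⟨hi, hj⟩ := M.aux_S_prop hmem
  have hi' : (0:ℝ) < i := by exact_mod_cast hi
  have hj' : (0:ℝ) < j := by exact_mod_cast (by omega : 0 < j)
  have hl := M.aux_intlam_pos
  have hψ := M.aux_ψ_pos
  have hr2 := M.aux_r_ge
  have hr : (0:ℝ) < M.r := by exact_mod_cast (by omega : 0 < M.r)
  have hC := M.aux_C_pos
  have hD := M.aux_D_pos hmem
  set D := M.auxD i j with hDdef
  set Bs : ℝ := ∑ t, (M.B t i j : ℝ) with hBs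
  have hBs0 : 0 ≤ Bs := Finset.sum_nonneg fun t _ => by positivity
  set As : ℝ := ∑ t, (M.A t M.r : ℝ) with hAs
  have hAs0 : 0 ≤ As := Finset.sum_nonneg fun t _ => by positivity
  set Dc : ℝ := M.Cparam / (M.r * M.intlam) with hDc
  have hDc0 : 0 < Dc := by positivity
  refine ⟨1 / i * (2 * (1 / i * Bs / D)) + j / (i * M.r) * (2 * (j / (i * M.r) * As / Dc)), by positivity, ?_⟩
  have ev0 : ∀ᶠ α : ℝ in nhdsWithin 0 (Set.Ioi 0), 0 < α := eventually_mem_nhdsWithin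
  have ev1 := aux_ev (1 / i * Bs / D) (1/2) (by norm_num)
  have ev2 := aux_ev (j / (i * M.r) * As / Dc) (1/2) (by norm_num)
  have ev3 : ∀ᶠ α : ℝ in nhdsWithin 0 (Set.Ioi 0), ∀ t, 1 / i * α ≤ M.δfrac t :=
    Filter.eventually_all.2 fun t => aux_ev _ _ (M.aux_δ_pos t)
  have ev4 : ∀ᶠ α : ℝ in nhdsWithin 0 (Set.Ioi 0), ∀ t, j / (i * M.r) * α ≤ 1 / M.intlam * M.ρ t / M.s t :=
    Filter.eventually_all.2 fun t => aux_ev _ _ (by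
      have := M.hρpos t; have := M.aux_s_pos t; positivity)
  have ev5 := aux_ev (1 / i) 1 (by norm_num)
  have ev6 := aux_ev (j / (i * M.r)) 1 (by norm_num)
  have ev7 := aux_ev (j / i) (1 / M.intlam) (by positivity)
  filter_upwards [ev0, ev1, ev2, ev3, ev4, ev5, ev6, ev7] with α hα h1 h2 h3 h4 h5 h6 h7
  intro n κ hI hw hκ
  obtain ⟨hn, hE, hc, hv, hfl⟩ := hI
  have hn' : (0:ℝ) < n := by exact_mod_cast hn
  have hκ' : (0:ℝ) < κ := by exact_mod_cast hκ
  have hκn : (i:ℝ) * M.r * κ = α * n := by rw [← hfl, hw]; push_cast; ring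
  -- VN side
  set k := M.r * κ with hk
  have hkn : (k:ℝ) = (1 / i * α) * n := by rw [hk]; push_cast; field_simp; linarith
  have hk1 : 1 ≤ k := by rw [hk]; exact Nat.mul_pos (by omega) hκ
  have hvE : ∀ t, (M.vExp n t : ℝ) = M.δfrac t * n := by
    intro t; rw [hv, hE]; unfold δfrac; have := M.aux_q_pos t; field_simp
  have hkv : ∀ t, k ≤ M.vExp n t := by
    intro t
    have : (k:ℝ) ≤ M.vExp n t := by rw [hkn, hvE]; gcongr; exact h3 t
    exact_mod_cast this
  have dv := AuxDom.prod Finset.univ (i := i) (j := j) (k := k) hi (M.vExp n) (fun t => (M.B t i j : ℝ))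
    M.Bpoly (fun t => by positivity) M.aux_BNN
    (fun t => by rw [aux_Bcoeff, M.hB00]; simp) (fun t => by rw [aux_Bcoeff]) hkv k le_rfl
  have sumv : ∑ t, (M.B t i j : ℝ) * ((M.vExp n t : ℝ) - k) = n * D - k * Bs := by
    rw [hDdef, hBs, auxD, Finset.mul_sum, Finset.mul_sum, ← Finset.sum_sub_distrib]
    refine Finset.sum_congr rfl fun t _ => ?_
    rw [hvE]; ring
  rw [sumv] at dv
  obtain ⟨pV, lV⟩ := aux_low D Bs (1 / i * α) _ n k hD hBs0 (by positivity) hn hk1 hkn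
    (by calc _ = (1 / i * Bs / D) * α := by ring
          _ ≤ _ := h1) dv
  -- CN side
  set m := j * κ with hm
  have hmn : (m:ℝ) = (j / (i * M.r) * α) * n := by
    rw [hm]; push_cast
    have : (κ:ℝ) = α * n / (i * M.r) := by field_simp; linarith
    rw [this]; field_simp
  have hm1 : 1 ≤ m := by rw [hm]; exact Nat.mul_pos (by omega) hκ
  have hcE : ∀ t, (M.cExp n t : ℝ) = 1 / M.intlam * M.ρ t / M.s t * n := by
    intro t; rw [hc, hE]; ring
  have hkc : ∀ t, m ≤ M.cExp n t := by
    intro t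
    have : (m:ℝ) ≤ M.cExp n t := by rw [hmn, hcE]; gcongr; exact h4 t
    exact_mod_cast this
  have dc := AuxDom.prod Finset.univ (i := M.r) (j := 0) (k := m) (by omega) (M.cExp n) (fun t => (M.A t M.r : ℝ))
    (fun t => (M.Apoly t).map Polynomial.C) (fun t => by positivity) M.aux_ANN
    (fun t => by rw [aux_Acoeff', M.hA0]; simp) (fun t => by rw [aux_Acoeff']; simp) hkc m le_rfl
  have sumc : ∑ t, (M.A t M.r : ℝ) * ((M.cExp n t : ℝ) - m) = n * Dc - m * As := by
    rw [hDc, hAs, aux_C_eq, mul_div_mul_left _ _ hr.ne', Finset.sum_div, Finset.mul_sum, Finset.mul_sum, ← Finset.sum_sub_distrib]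
    refine Finset.sum_congr rfl fun t _ => ?_
    rw [hcE]; ring
  rw [sumc] at dc
  obtain ⟨pC, lC⟩ := aux_low Dc As (j / (i * M.r) * α) _ n m hDc0 hAs0 (by positivity) hn hm1 hmn
    (by calc _ = (j / (i * M.r) * As / Dc) * α := by ring
          _ ≤ _ := h2) dc
  -- binomial
  set v := k * j with hvdef
  have hvm : m * M.r = v := by rw [hvdef, hk, hm]; ring
  have hwk : k * i = ⌊α * (n:ℝ)⌋₊ := by rw [hw, hk]; ring
  rw [hvm, mul_zero] at pC lC
  have cV : M.NvCount n ⌊α * (n:ℝ)⌋₊ v = ((∏ t, M.Bpoly t ^ M.vExp n t).coeff (k * i)).coeff v := by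
    rw [hwk]; rfl
  have cC : M.NcCount n v = ((∏ t, (M.Apoly t).map Polynomial.C ^ M.cExp n t).coeff v).coeff 0 := M.aux_Nc n v
  rw [← cV] at pV lV
  rw [← cC] at pC lC
  have hvn : (v:ℝ) = (j / i * α) * n := by rw [hvdef]; push_cast; rw [hkn]; ring
  have hvle : v ≤ M.En n := by
    have : (v:ℝ) ≤ M.En n := by
      rw [hvn, hE]
      calc (j / i * α) * (n:ℝ) ≤ 1 / M.intlam * n := by gcongr
        _ = _ := by ring
    exact_mod_cast this
  have hch : (0:ℝ) < ((M.En n).choose v : ℝ) := by exact_mod_cast Nat.choose_pos hvle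
  have hv0 : (0:ℝ) < v := by rw [hvn]; positivity
  have hE0 : (0:ℝ) < M.En n := by rw [hE]; positivity
  have lB : Real.log ((M.En n).choose v : ℝ) ≤
      n * ((j / i * α) * (- Real.log M.intlam - Real.log (j / i * α) + 1)) := by
    have b1 := Real.log_le_log hch (Nat.choose_le_pow_div (α := ℝ) v (M.En n))
    have hf : (0:ℝ) < (v.factorial : ℝ) := by exact_mod_cast v.factorial_pos
    rw [Real.log_div (by positivity) (by positivity), Real.log_pow] at b1
    have b2 := aux_log_fact_ge v
    have b3 : Real.log (M.En n : ℝ) = Real.log n - Real.log M.intlam := by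
      rw [hE, Real.log_div (by positivity) (by positivity)]
    have b4 : Real.log (v : ℝ) = Real.log (j / i * α) + Real.log n := by
      rw [hvn, Real.log_mul (by positivity) (by positivity)]
    rw [b3] at b1
    rw [b4] at b2
    have b5 : (n:ℝ) * ((j / i * α) * (- Real.log M.intlam - Real.log (j / i * α) + 1)) =
      v * (- Real.log M.intlam - Real.log (j / i * α) + 1) := by rw [hvn]; ring
    rw [b5]
    nlinarith
  have tl := M.aux_term_le n ⌊α * (n:ℝ)⌋₊ v hvle
  have tp : 0 < M.NvCount n ⌊α * (n:ℝ)⌋₊ v * M.NcCount n v / ((M.En n).choose v : ℝ) := by positivity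
  refine ⟨lt_of_lt_of_le tp tl, ?_⟩
  have lE := Real.log_le_log tp tl
  rw [Real.log_div (by positivity) (by positivity), Real.log_mul (by positivity) (by positivity)] at lE
  have lk : Real.log k ≤ Real.log n := by
    refine Real.log_le_log (by exact_mod_cast hk1) ?_
    rw [hkn]; nlinarith
  have lm : Real.log m ≤ Real.log n := by
    refine Real.log_le_log (by exact_mod_cast hm1) ?_
    rw [hmn]; nlinarith
  have ln0 : 0 ≤ Real.log (n:ℝ) := Real.log_nonneg (by exact_mod_cast hn)
  have hcc := M.aux_c_ge
  have main := M.aux_main_eq2 hmem hT hα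
  rw [← hDdef, ← hDc] at main
  rw [main]
  have expand : (n:ℝ) * ((1 / i * α) * (Real.log D - Real.log (1 / i * α) + 1) +
      (j / (i * M.r) * α) * (Real.log Dc - Real.log (j / (i * M.r) * α) + 1) -
      (j / i * α) * (- Real.log M.intlam - Real.log (j / i * α) + 1) -
      (1 / i * (2 * (1 / i * Bs / D)) + j / (i * M.r) * (2 * (j / (i * M.r) * As / Dc))) * α ^ 2) =
      n * ((1 / i * α) * (Real.log D - Real.log (1 / i * α) + 1 - 2 * (1 / i * α * Bs / D))) +
      n * ((j / (i * M.r) * α) * (Real.log Dc - Real.log (j / (i * M.r) * α) + 1 - 2 * (j / (i * M.r) * α * As / Dc))) -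
      n * ((j / i * α) * (- Real.log M.intlam - Real.log (j / i * α) + 1)) := by ring
  rw [expand]
  linarith

end DGLDPC

lemma aux_log_choose_ge (E v : ℕ) (hv : 1 ≤ v) (hvE : (v:ℝ) / E ≤ 1 / 2) (hE : 1 ≤ E) :
    (v:ℝ) * Real.log E - 2 * v ^ 2 / E - v * Real.log v + v - Real.log v - 1 ≤ Real.log (E.choose v : ℝ) := by
  have hE' : (0:ℝ) < E := by exact_mod_cast hE
  have hv' : (0:ℝ) < v := by exact_mod_cast hv
  have hle : (v:ℝ) ≤ E := by rw [div_le_iff₀ hE'] at hvE; linarith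
  have hle' : v ≤ E := by exact_mod_cast hle
  have hf : (0:ℝ) < (v.factorial : ℝ) := by exact_mod_cast v.factorial_pos
  have h1 := Nat.pow_le_choose (α := ℝ) v E
  have hs : (((E + 1 - v : ℕ) : ℝ)) = E + 1 - v := by
    rw [Nat.cast_sub (by omega)]; push_cast; ring
  rw [hs] at h1
  have hb : (E:ℝ) * (1 - v / E) ≤ E + 1 - v := by
    have : (E:ℝ) * (1 - v / E) = E - v := by field_simp
    linarith
  have hp : 0 < 1 - (v:ℝ) / E := by linarith
  have h2 : ((E:ℝ) * (1 - v / E)) ^ v / (v.factorial : ℝ) ≤ (E.choose v : ℝ) := by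
    refine le_trans ?_ h1
    gcongr
  have h3 := Real.log_le_log (by positivity) h2
  rw [Real.log_div (by positivity) (by positivity), Real.log_pow, Real.log_mul hE'.ne' hp.ne'] at h3
  have h4 := aux_log_fact_le v hv
  have h5 := aux_log_one_sub ((v:ℝ) / E) (by positivity) hvE
  have h6 : (v:ℝ) * (-(2 * (v / E))) ≤ v * Real.log (1 - v / E) := by gcongr
  have h7 : (v:ℝ) * (-(2 * (v / E))) = - (2 * v ^ 2 / E) := by ring
  nlinarith

namespace DGLDPC
variable (M : DGLDPC)

lemma aux_T_bdd : BddBelow {x : ℝ | ∃ ij ∈ M.Sminus, x = M.Tij ij.1 ij.2} := by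
  refine ⟨0, ?_⟩
  rintro x ⟨⟨a, b⟩, h, rfl⟩
  obtain ⟨h1, h2⟩ := M.aux_S_prop h
  have : (2:ℝ) ≤ b := by exact_mod_cast h2
  have := M.aux_ψ_le
  exact div_nonneg (by simp only; linarith) (by positivity)

lemma aux_T_le {a b : ℕ} (h : (a, b) ∈ M.Sminus) : M.T ≤ M.Tij a b :=
  csInf_le M.aux_T_bdd ⟨(a, b), h, rfl⟩

lemma aux_xi_bdd : BddBelow M.xiSet := by
  refine ⟨0, ?_⟩
  have := M.aux_ψ_pos
  rintro x ((h | ⟨i, -, -, rfl⟩) | ⟨⟨a, b⟩, h, hlt, rfl⟩)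
  · rw [Set.mem_singleton_iff] at h; rw [h]; norm_num
  · positivity
  · have : 0 < M.Tij a b - M.T := by simp only at hlt; linarith
    simp only
    positivity

lemma aux_pow_le {x α : ℝ} (hx : x ∈ M.xiSet) (h0 : 0 < α) (h1 : α ≤ 1) : α ^ x ≤ α ^ M.ξexp :=
  Real.rpow_le_rpow_of_exponent_ge h0 h1 (csInf_le M.aux_xi_bdd hx)

lemma aux_sq_le {α : ℝ} (h0 : 0 < α) (h1 : α ≤ 1) : α ^ 2 ≤ α ^ M.ξexp := by
  have := M.aux_pow_le (x := 2) (Or.inl (Or.inl rfl)) h0 h1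
  exact_mod_cast this

lemma aux_log_Nv (n w v : ℕ) (x y : ℝ) (hx : 0 < x) (hy : 0 < y) (hp : 0 < M.NvCount n w v) :
    Real.log (M.NvCount n w v) ≤ ∑ t, (M.vExp n t : ℝ) * ((M.Bpoly t).evalEval y x - 1)
      - w * Real.log x - v * Real.log y := by
  have h1 := (M.aux_VNN n).le_evalEval x y hx.le hy.le w v
  rw [← aux_Nv] at h1
  have h2 : (M.auxVP n).evalEval y x ≤
      Real.exp (∑ t, (M.vExp n t : ℝ) * ((M.Bpoly t).evalEval y x - 1)) := by
    unfold auxVP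
    rw [Real.exp_sum, ← coe_evalEvalRingHom, map_prod]
    refine Finset.prod_le_prod (fun t _ => ?_) fun t _ => ?_
    · rw [map_pow]
      refine pow_nonneg ?_ _
      have := (M.aux_BNN t).le_evalEval x y hx.le hy.le 0 0
      refine le_trans ?_ this
      have := M.aux_BNN t 0 0
      positivity
    · rw [map_pow, Real.exp_nat_mul]
      have h0 : 0 ≤ (M.Bpoly t).evalEval y x := by
        have := (M.aux_BNN t).le_evalEval x y hx.le hy.le 0 0
        refine le_trans ?_ this
        have := M.aux_BNN t 0 0
        positivity
      rw [coe_evalEvalRingHom]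
      refine pow_le_pow_left₀ h0 ?_ _
      have := Real.add_one_le_exp ((M.Bpoly t).evalEval y x - 1)
      linarith
  have h3 := Real.log_le_log (by positivity) (h1.trans h2)
  rw [Real.log_exp, Real.log_mul hp.ne' (by positivity), Real.log_mul (by positivity) (by positivity),
    Real.log_pow, Real.log_pow] at h3
  linarith

lemma aux_log_Nc (n v : ℕ) (z : ℝ) (hz : 0 < z) (hp : 0 < M.NcCount n v) :
    Real.log (M.NcCount n v) ≤ ∑ t, (M.cExp n t : ℝ) * ((M.Apoly t).eval z - 1)
      - v * Real.log z := by
  have hA : ∀ t, 0 ≤ (M.Apoly t).eval z := fun t => by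
    have := aux_uni_le_eval (M.Apoly t) (fun v => by rw [aux_Acoeff]; positivity) z hz.le 0
    refine le_trans ?_ this
    rw [aux_Acoeff]; positivity
  have h1 : M.NcCount n v * z ^ v ≤ (∏ t, M.Apoly t ^ M.cExp n t).eval z := by
    unfold NcCount
    refine aux_uni_le_eval _ (fun v => ?_) z hz.le v
    exact M.aux_Nc_nonneg n v
  have h2 : (∏ t, M.Apoly t ^ M.cExp n t).eval z ≤
      Real.exp (∑ t, (M.cExp n t : ℝ) * ((M.Apoly t).eval z - 1)) := by
    rw [Real.exp_sum, eval_prod]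
    refine Finset.prod_le_prod (fun t _ => ?_) fun t _ => ?_
    · rw [eval_pow]
      exact pow_nonneg (hA t) _
    · rw [eval_pow, Real.exp_nat_mul]
      refine pow_le_pow_left₀ (hA t) ?_ _
      have := Real.add_one_le_exp ((M.Apoly t).eval z - 1)
      linarith
  have h3 := Real.log_le_log (by positivity) (h1.trans h2)
  rw [Real.log_exp, Real.log_mul hp.ne' (by positivity), Real.log_pow] at h3
  linarith

/-- big box -/
noncomputable def auxBox : Finset (ℕ × ℕ) :=
  (Finset.range (∑ t, M.kdim t + 1) ×ˢ Finset.range (∑ t, M.q t + 1)).erase (0, 0)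

lemma aux_Beval (t : Fin M.nv) (x y : ℝ) : (M.Bpoly t).evalEval y x - 1 =
    ∑ ab ∈ M.auxBox, (M.B t ab.1 ab.2 : ℝ) * (x ^ ab.1 * y ^ ab.2) := by
  have h1 : (M.Bpoly t).evalEval y x = ∑ ab ∈ Finset.range (M.kdim t + 1) ×ˢ Finset.range (M.q t + 1),
      (M.B t ab.1 ab.2 : ℝ) * (x ^ ab.1 * y ^ ab.2) := by
    rw [Finset.sum_product]
    unfold Bpoly
    rw [← coe_evalEvalRingHom, map_sum]
    refine Finset.sum_congr rfl fun u _ => ?_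
    simp only [map_mul, map_pow, coe_evalEvalRingHom, evalEval_C, evalEval_X, eval_finsetSum, eval_mul,
      eval_C, eval_pow, eval_X]
    rw [Finset.sum_mul]
    refine Finset.sum_congr rfl fun v _ => ?_
    ring
  have hk : M.kdim t ≤ ∑ t, M.kdim t := Finset.single_le_sum (f := M.kdim) (fun _ _ => Nat.zero_le _) (Finset.mem_univ t)
  have hq : M.q t ≤ ∑ t, M.q t := Finset.single_le_sum (f := M.q) (fun _ _ => Nat.zero_le _) (Finset.mem_univ t)
  have h2 : (M.Bpoly t).evalEval y x = ∑ ab ∈ Finset.range (∑ t, M.kdim t + 1) ×ˢ Finset.range (∑ t, M.q t + 1),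
      (M.B t ab.1 ab.2 : ℝ) * (x ^ ab.1 * y ^ ab.2) := by
    rw [h1]
    refine Finset.sum_subset (Finset.product_subset_product (Finset.range_mono (by omega)) (Finset.range_mono (by omega))) ?_
    rintro ⟨a, b⟩ - h
    simp only [Finset.mem_product, Finset.mem_range, not_and_or] at h
    have : M.B t a b = 0 := by
      apply M.hBsupp
      · omega
      · omega
    simp [this]
  have h3 := Finset.add_sum_erase (Finset.range (∑ t, M.kdim t + 1) ×ˢ Finset.range (∑ t, M.q t + 1))
    (fun ab => (M.B t ab.1 ab.2 : ℝ) * (x ^ ab.1 * y ^ ab.2)) (a := (0, 0)) (by simp)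
  rw [h2, ← h3, M.hB00]
  unfold auxBox
  simp

lemma aux_Aeval (t : Fin M.nc) (z : ℝ) : (M.Apoly t).eval z - 1 =
    ∑ u ∈ Finset.Icc M.r (∑ t, M.s t), (M.A t u : ℝ) * z ^ u := by
  have h1 : (M.Apoly t).eval z = ∑ u ∈ Finset.range (M.s t + 1), (M.A t u : ℝ) * z ^ u := by
    unfold Apoly
    simp [eval_finsetSum]
  have hs : M.s t ≤ ∑ t, M.s t := Finset.single_le_sum (f := M.s) (fun _ _ => Nat.zero_le _) (Finset.mem_univ t)
  have hr := M.aux_r_ge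
  have hr' := M.aux_r_le t
  have h2 : ∑ u ∈ Finset.range (M.s t + 1), (M.A t u : ℝ) * z ^ u =
      ∑ u ∈ insert 0 (Finset.Icc M.r (∑ t, M.s t)), (M.A t u : ℝ) * z ^ u := by
    have e1 : ∑ u ∈ Finset.range (M.s t + 1), (M.A t u : ℝ) * z ^ u =
      ∑ u ∈ Finset.range (∑ t, M.s t + 1), (M.A t u : ℝ) * z ^ u := by
      refine Finset.sum_subset (Finset.range_mono (by omega)) fun u _ h => ?_
      rw [Finset.mem_range] at h
      rw [M.hAsupp t u (by omega) (by omega)]; simp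
    rw [e1]
    symm
    refine Finset.sum_subset ?_ fun u h1 h => ?_
    · intro u; simp only [Finset.mem_insert, Finset.mem_Icc, Finset.mem_range]; omega
    · simp only [Finset.mem_insert, Finset.mem_Icc, Finset.mem_range, not_or] at h h1
      rw [M.hAsupp t u (by omega) (by omega)]; simp
  rw [h1, h2, Finset.sum_insert (by simp; omega), M.hA0]
  simp

end DGLDPC

namespace DGLDPC
variable (M : DGLDPC)

noncomputable def auxCu (u : ℕ) : ℝ := ∑ t, M.ρ t * (M.A t u : ℝ) / (M.s t : ℝ)

lemma aux_Cu_nonneg (u : ℕ) : 0 ≤ M.auxCu u :=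
  Finset.sum_nonneg fun t _ => by have := M.hρpos t; positivity

lemma aux_cn_bound : ∃ K : ℝ, 0 ≤ K ∧ ∀ (α : ℝ) (n v : ℕ), 0 < α → α ≤ 1 → M.auxInt α n → 1 ≤ v →
    (v:ℝ) ≤ (∑ t, M.q t : ℕ) * (α * n) → 0 < M.NcCount n v →
    Real.log (M.NcCount n v) ≤ (v:ℝ) / M.r + v / M.r * Real.log M.Cparam
      - v / M.r * Real.log (v / M.En n) + n * (K * α ^ M.ξexp) := by
  set Q : ℝ := ((∑ t, M.q t : ℕ) : ℝ) with hQ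
  have hQ0 : 0 ≤ Q := by positivity
  have hl := M.aux_intlam_pos
  have hr2 := M.aux_r_ge
  have hr : (0:ℝ) < M.r := by exact_mod_cast (by omega : 0 < M.r)
  have hC := M.aux_C_pos
  set S := ∑ t, M.s t with hS
  refine ⟨∑ u ∈ Finset.Ioc M.r S, M.auxCu u / M.intlam * (Q * M.intlam / M.Cparam) ^ ((u:ℝ) / M.r),
    Finset.sum_nonneg fun u _ => by have := M.aux_Cu_nonneg u; positivity, ?_⟩
  intro α n v hα hα1 hI hv hvQ hp
  have hE1 := aux_En_pos hI
  obtain ⟨hn, hE, hc, hv', hfl⟩ := hI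
  have hn' : (0:ℝ) < n := by exact_mod_cast hn
  have hE0 : (0:ℝ) < M.En n := by exact_mod_cast hE1
  have hv0 : (0:ℝ) < v := by exact_mod_cast hv
  set g : ℝ := v / (M.Cparam * M.En n) with hg
  have hg0 : 0 < g := by positivity
  have hgle : g ≤ Q * M.intlam / M.Cparam * α := by
    rw [hg, div_le_iff₀ (by positivity), hE]
    calc (v:ℝ) ≤ Q * (α * n) := hvQ
      _ = _ := by field_simp
  set z : ℝ := g ^ ((1:ℝ) / M.r) with hz
  have hz0 : 0 < z := by positivity
  have hzu : ∀ u : ℕ, z ^ u = g ^ ((u:ℝ) / M.r) := by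
    intro u
    rw [hz, ← Real.rpow_natCast, ← Real.rpow_mul hg0.le]
    congr 1; ring
  have hlz : Real.log z = 1 / M.r * (Real.log (v / M.En n) - Real.log M.Cparam) := by
    rw [hz, Real.log_rpow hg0, hg, show (v:ℝ) / (M.Cparam * M.En n) = (v / M.En n) / M.Cparam by field_simp,
      Real.log_div (by positivity) hC.ne']
  have h1 := M.aux_log_Nc n v z hz0 hp
  have h2 : ∑ t, (M.cExp n t : ℝ) * ((M.Apoly t).eval z - 1) =
      ∑ u ∈ Finset.Icc M.r S, M.En n * (M.auxCu u * z ^ u) := by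
    simp_rw [aux_Aeval, Finset.mul_sum]
    rw [Finset.sum_comm]
    refine Finset.sum_congr rfl fun u _ => ?_
    rw [auxCu, Finset.sum_mul, Finset.mul_sum]
    refine Finset.sum_congr rfl fun t _ => ?_
    rw [hc]; ring
  have hrS : M.r ≤ S := by
    obtain ⟨t, ht⟩ := M.aux_r_mem
    have : M.s t ≤ S := Finset.single_le_sum (f := M.s) (fun _ _ => Nat.zero_le _) (Finset.mem_univ t)
    have := M.h_rds t
    omega
  rw [h2, ← Finset.add_sum_Ioc_eq_sum_Icc hrS] at h1
  have h3 : (M.En n : ℝ) * (M.auxCu M.r * z ^ M.r) = v / M.r := by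
    have : M.Cparam = M.r * M.auxCu M.r := M.aux_C_eq
    have e : M.auxCu M.r = M.Cparam / M.r := by rw [this]; field_simp
    rw [hzu, div_self hr.ne', Real.rpow_one, e, hg]
    field_simp
  have h4 : ∑ u ∈ Finset.Ioc M.r S, (M.En n : ℝ) * (M.auxCu u * z ^ u) ≤
      n * ((∑ u ∈ Finset.Ioc M.r S, M.auxCu u / M.intlam * (Q * M.intlam / M.Cparam) ^ ((u:ℝ) / M.r)) * α ^ M.ξexp) := by
    rw [Finset.sum_mul, Finset.mul_sum]
    refine Finset.sum_le_sum fun u hu => ?_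
    rcases (M.aux_Cu_nonneg u).eq_or_lt with h0 | h0
    · rw [← h0]; simp
    have hmem : (u:ℝ) / M.r ∈ M.xiSet := by
      refine Or.inl (Or.inr ⟨u, (Finset.mem_Ioc.1 hu).1, ?_, rfl⟩)
      by_contra hcon
      push Not at hcon
      have : M.auxCu u = 0 := Finset.sum_eq_zero fun t _ => by
        have := hcon t
        rw [Nat.le_zero.1 this]; simp
      linarith
    have hb : z ^ u ≤ (Q * M.intlam / M.Cparam) ^ ((u:ℝ) / M.r) * α ^ M.ξexp := by
      rw [hzu]
      calc g ^ ((u:ℝ) / M.r) ≤ (Q * M.intlam / M.Cparam * α) ^ ((u:ℝ) / M.r) := by gcongr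
        _ = (Q * M.intlam / M.Cparam) ^ ((u:ℝ) / M.r) * α ^ ((u:ℝ) / M.r) := Real.mul_rpow (by positivity) hα.le
        _ ≤ _ := mul_le_mul_of_nonneg_left (M.aux_pow_le hmem hα hα1) (by positivity)
    rw [hE]
    calc (n:ℝ) / M.intlam * (M.auxCu u * z ^ u) ≤ n / M.intlam * (M.auxCu u * ((Q * M.intlam / M.Cparam) ^ ((u:ℝ) / M.r) * α ^ M.ξexp)) := by gcongr
      _ = _ := by ring
  rw [h3] at h1
  have h5 : (v:ℝ) * Real.log z = - (v / M.r * Real.log M.Cparam) + v / M.r * Real.log (v / M.En n) := by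
    rw [hlz]; ring
  linarith

lemma aux_expo (i j a b ψ lα li L τ : ℝ) (hi : i ≠ 0) (hψ : ψ ≠ 0) :
    a * (1 / i * (lα - li - j * (L + 1 / ψ * lα + τ))) + b * (L + 1 / ψ * lα + τ) =
    (-(a / i * li) + (b - a * j / i) * (L + τ)) + lα * ((b - a * ((j - ψ) / i)) / ψ) := by
  field_simp
  ring

lemma aux_vn_bound {i j : ℕ} (hmem : (i, j) ∈ M.Sminus) (hT : M.Tij i j = M.T)
    (huniq : ∀ i' j', (i', j') ∈ M.Sminus → M.Tij i' j' = M.T → (i', j') = (i, j)) (τ : ℝ) :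
    ∃ K : ℝ, 0 ≤ K ∧ ∀ (α : ℝ) (n v : ℕ) (Y : ℝ), 0 < α → α ≤ 1 → M.auxInt α n →
    0 < M.NvCount n ⌊α * (n:ℝ)⌋₊ v →
    Y = (1 / M.r * Real.log M.Cparam + 1 / M.ψ * (Real.log (j * α * M.intlam / i) - 1)) + τ →
    Real.log (M.NvCount n ⌊α * (n:ℝ)⌋₊ v) ≤ n * (α / i) + n * (K * α ^ M.ξexp)
      - α * n * (1 / i * (Real.log α - Real.log (i * M.auxD i j) - j * Y)) - v * Y := by
  obtain ⟨hi, hj⟩ := M.aux_S_prop hmem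
  have hi' : (0:ℝ) < i := by exact_mod_cast hi
  have hj' : (0:ℝ) < j := by exact_mod_cast (by omega : 0 < j)
  have hl := M.aux_intlam_pos
  have hψ := M.aux_ψ_pos
  have hD := M.aux_D_pos hmem
  set L : ℝ := 1 / M.r * Real.log M.Cparam + 1 / M.ψ * (Real.log (j * M.intlam / i) - 1) with hL
  set cst : ℕ × ℕ → ℝ := fun ab => Real.exp (-(ab.1 / i * Real.log (i * M.auxD i j)) + (ab.2 - ab.1 * j / i) * (L + τ)) with hcst
  refine ⟨∑ ab ∈ M.auxBox.erase (i, j), M.auxD ab.1 ab.2 * cst ab,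
    Finset.sum_nonneg fun ab _ => mul_nonneg (M.aux_D_nonneg _ _) (Real.exp_pos _).le, ?_⟩
  intro α n v Y hα hα1 hI hp hY
  obtain ⟨hn, hE, hc, hv, hfl⟩ := hI
  have hn' : (0:ℝ) < n := by exact_mod_cast hn
  have hY' : Y = L + 1 / M.ψ * Real.log α + τ := by
    rw [hY, hL, show (j:ℝ) * α * M.intlam / i = (j * M.intlam / i) * α by ring,
      Real.log_mul (by positivity) hα.ne']
    ring
  set X : ℝ := 1 / i * (Real.log α - Real.log (i * M.auxD i j) - j * Y) with hX
  have h1 := M.aux_log_Nv n ⌊α * (n:ℝ)⌋₊ v (Real.exp X) (Real.exp Y) (Real.exp_pos _) (Real.exp_pos _) hp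
  rw [Real.log_exp, Real.log_exp, hfl] at h1
  have hvE : ∀ t, (M.vExp n t : ℝ) = M.δfrac t * n := by
    intro t; rw [hv, hE]; unfold δfrac; have := M.aux_q_pos t; field_simp
  have h2 : ∑ t, (M.vExp n t : ℝ) * ((M.Bpoly t).evalEval (Real.exp Y) (Real.exp X) - 1) =
      ∑ ab ∈ M.auxBox, n * (M.auxD ab.1 ab.2 * Real.exp (ab.1 * X + ab.2 * Y)) := by
    simp_rw [aux_Beval, Finset.mul_sum]
    rw [Finset.sum_comm]
    refine Finset.sum_congr rfl fun ab _ => ?_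
    rw [auxD, Finset.sum_mul, Finset.mul_sum]
    refine Finset.sum_congr rfl fun t _ => ?_
    rw [hvE, Real.exp_add, Real.exp_nat_mul, Real.exp_nat_mul]; ring
  have hbox : (i, j) ∈ M.auxBox := by
    obtain ⟨⟨t, ht⟩, h0⟩ := hmem
    have := M.aux_Bsupp_prop t i j ht.ne' h0
    have hk : M.kdim t ≤ ∑ t, M.kdim t := Finset.single_le_sum (f := M.kdim) (fun _ _ => Nat.zero_le _) (Finset.mem_univ t)
    have hq : M.q t ≤ ∑ t, M.q t := Finset.single_le_sum (f := M.q) (fun _ _ => Nat.zero_le _) (Finset.mem_univ t)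
    unfold auxBox
    rw [Finset.mem_erase, Finset.mem_product, Finset.mem_range, Finset.mem_range]
    refine ⟨h0, ?_, ?_⟩ <;> simp only <;> omega
  rw [h2, ← Finset.add_sum_erase _ _ hbox] at h1
  have h3 : (n:ℝ) * (M.auxD i j * Real.exp (i * X + j * Y)) = n * (α / i) := by
    have : (i:ℝ) * X + j * Y = Real.log α - Real.log (i * M.auxD i j) := by rw [hX]; field_simp; ring
    rw [this, Real.exp_sub, Real.exp_log hα, Real.exp_log (by positivity)]
    field_simp
  have h4 : ∑ ab ∈ M.auxBox.erase (i, j), (n:ℝ) * (M.auxD ab.1 ab.2 * Real.exp (ab.1 * X + ab.2 * Y)) ≤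
      n * ((∑ ab ∈ M.auxBox.erase (i, j), M.auxD ab.1 ab.2 * cst ab) * α ^ M.ξexp) := by
    rw [Finset.sum_mul, Finset.mul_sum]
    refine Finset.sum_le_sum fun ab hab => ?_
    obtain ⟨a, b⟩ := ab
    rcases (M.aux_D_nonneg a b).eq_or_lt with h0 | h0
    · simp only [← h0]; simp
    have hne : (a, b) ≠ (i, j) := (Finset.mem_erase.1 hab).1
    have hS : (a, b) ∈ M.Sminus := by
      refine ⟨?_, (Finset.mem_erase.1 (Finset.mem_erase.1 hab).2).1⟩
      by_contra hcon
      push Not at hcon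
      have : M.auxD a b = 0 := Finset.sum_eq_zero fun t _ => by
        have := hcon t
        simp only at this
        rw [Nat.le_zero.1 this]; simp
      linarith
    obtain ⟨ha, hb⟩ := M.aux_S_prop hS
    have ha' : (0:ℝ) < a := by exact_mod_cast ha
    have hlt : M.T < M.Tij a b := lt_of_le_of_ne (M.aux_T_le hS) fun h => hne (huniq a b hS h.symm)
    have hxi : ((b:ℝ) - a * M.T) / M.ψ ∈ M.xiSet := by
      refine Or.inr ⟨(a, b), hS, hlt, ?_⟩
      simp only [Tij]
      field_simp
      ring
    have hb : Real.exp (a * X + b * Y) ≤ cst (a, b) * α ^ M.ξexp := by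
      have e : (a:ℝ) * X + b * Y = (-(a / i * Real.log (i * M.auxD i j)) + (b - a * j / i) * (L + τ)) +
          Real.log α * (((b:ℝ) - a * M.T) / M.ψ) := by
        rw [hX, hY', ← hT, Tij]
        exact aux_expo _ _ _ _ _ _ _ _ _ hi'.ne' hψ.ne'
      rw [e, Real.exp_add, ← Real.rpow_def_of_pos hα]
      refine mul_le_mul_of_nonneg_left (M.aux_pow_le hxi hα hα1) (Real.exp_pos _).le
    calc (n:ℝ) * (M.auxD a b * Real.exp (a * X + b * Y)) ≤ n * (M.auxD a b * (cst (a, b) * α ^ M.ξexp)) := by gcongr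
      _ = _ := by ring
  simp only at h1
  rw [h3] at h1
  linarith

lemma aux_comb_alg (n α i j v E w0 lC r ψ ℓ0 lvE τ lα liD K1 K2 K3 lE lv lN lM lB ξ : ℝ)
    (hi : i ≠ 0) (hψ : 1 / ψ = 1 - 1 / r)
    (hw0 : w0 = j * (α * n) / i)
    (hN : lN ≤ n * (α / i) + n * (K1 * ξ) -
      α * n * (1 / i * (lα - liD - j * ((1 / r * lC + 1 / ψ * (ℓ0 - 1)) + τ))) - v * ((1 / r * lC + 1 / ψ * (ℓ0 - 1)) + τ))
    (hM : lM ≤ v / r + v / r * lC - v / r * lvE + n * (K2 * ξ))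
    (hB : v * lE - 2 * v ^ 2 / E - v * lv + v - lv - 1 ≤ lB)
    (hlv : lvE = lv - lE)
    (hK3 : 2 * v ^ 2 / E ≤ n * (K3 * ξ))
    (hτ : (w0 - v) * τ + 1 / ψ * (v * (lvE - ℓ0)) ≤ 0) :
    lN + lM - lB ≤ n * ((α / i * (1 - lα + liD) +
      j * α / i * (1 / r * lC + 1 / ψ * (ℓ0 - 1))) + (K1 + K2 + K3) * ξ) + lv + 1 := by
  have key : n * (α / i) -
      α * n * (1 / i * (lα - liD - j * ((1 / r * lC + 1 / ψ * (ℓ0 - 1)) + τ))) - v * ((1 / r * lC + 1 / ψ * (ℓ0 - 1)) + τ)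
      + (v / r + v / r * lC - v / r * lvE) - (v * lE - v * lv + v) =
      n * (α / i * (1 - lα + liD) +
      j * α / i * (1 / r * lC + 1 / ψ * (ℓ0 - 1))) + ((w0 - v) * τ + 1 / ψ * (v * (lvE - ℓ0))) := by
    rw [hw0, hψ, hlv]
    field_simp
    ring
  linarith

end DGLDPC

namespace DGLDPC
variable (M : DGLDPC)

theorem aux_upper {i j : ℕ} (hmem : (i, j) ∈ M.Sminus) (hT : M.Tij i j = M.T)
    (huniq : ∀ i' j', (i', j') ∈ M.Sminus → M.Tij i' j' = M.T → (i', j') = (i, j)) :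
    ∃ K : ℝ, 0 ≤ K ∧ ∀ᶠ α : ℝ in nhdsWithin 0 (Set.Ioi 0), ∀ n : ℕ, M.Adm α n →
      Real.log (M.ENw n ⌊α * (n:ℝ)⌋₊) ≤ n * (M.auxMain i j α + K * α ^ M.ξexp) +
        (4 * Real.log n + M.auxc) := by
  obtain ⟨hi, hj⟩ := M.aux_S_prop hmem
  have hi' : (0:ℝ) < i := by exact_mod_cast hi
  have hj' : (0:ℝ) < j := by exact_mod_cast (by omega : 0 < j)
  have hl := M.aux_intlam_pos
  have hψ := M.aux_ψ_pos
  have hr2 := M.aux_r_ge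
  have hr : (0:ℝ) < M.r := by exact_mod_cast (by omega : 0 < M.r)
  have hC := M.aux_C_pos
  have hD := M.aux_D_pos hmem
  set Q : ℝ := ((∑ t, M.q t : ℕ) : ℝ) with hQ
  have hQ0 : 0 ≤ Q := by positivity
  set U : ℝ := Q * i / j with hU
  obtain ⟨Ka, hKa, hA⟩ := M.aux_vn_bound hmem hT huniq 0
  obtain ⟨Kb, hKb, hB⟩ := M.aux_vn_bound hmem hT huniq (U / M.ψ)
  obtain ⟨K2, hK2, hcn⟩ := M.aux_cn_bound
  refine ⟨(Ka + Kb) + K2 + 2 * Q ^ 2 * M.intlam, by positivity, ?_⟩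
  have ev0 : ∀ᶠ α : ℝ in nhdsWithin 0 (Set.Ioi 0), 0 < α := eventually_mem_nhdsWithin
  have ev1 := aux_ev 1 1 (by norm_num)
  have ev2 := aux_ev (Q * M.intlam) (1/2) (by norm_num)
  filter_upwards [ev0, ev1, ev2] with α hα hα1 h2
  rw [one_mul] at hα1
  intro n hAdm
  have hI := Adm.toInt hAdm
  have hpos : 0 < M.ENw n ⌊α * (n:ℝ)⌋₊ := hAdm.2.2.2.2.2
  have hE1 := aux_En_pos hI
  have hE0 : (0:ℝ) < M.En n := by exact_mod_cast hE1
  obtain ⟨hn, hE, hc, hv', hfl⟩ := id hI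
  have hn' : (0:ℝ) < n := by exact_mod_cast hn
  obtain ⟨v, hvE, hle⟩ := M.aux_exists_term n ⌊α * (n:ℝ)⌋₊
  have hch : (0:ℝ) < ((M.En n).choose v : ℝ) := by exact_mod_cast Nat.choose_pos hvE
  have hNv : 0 < M.NvCount n ⌊α * (n:ℝ)⌋₊ v := by
    refine lt_of_le_of_ne (M.aux_Nv_nonneg _ _ _) fun h => ?_
    rw [← h] at hle; simp at hle; linarith
  have hNc : 0 < M.NcCount n v := by
    refine lt_of_le_of_ne (M.aux_Nc_nonneg _ _) fun h => ?_
    rw [← h] at hle; simp at hle; linarith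
  have hsupp : AuxSupp (∑ t, M.q t) (∑ t, M.kdim t) (M.auxVP n) :=
    AuxSupp.prod _ _ fun t => (M.aux_Bsupp t).pow _
  obtain ⟨hs1, hs2⟩ := hsupp ⌊α * (n:ℝ)⌋₊ v hNv.ne'
  have hw1 : 0 < ⌊α * (n:ℝ)⌋₊ := by
    have : (0:ℝ) < ⌊α * (n:ℝ)⌋₊ := by rw [hfl]; positivity
    exact_mod_cast this
  have hv1 : 1 ≤ v := by
    rcases Nat.eq_zero_or_pos v with h | h
    · rw [h] at hs2; omega
    · exact h
  have hv0 : (0:ℝ) < v := by exact_mod_cast hv1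
  have hvQ : (v:ℝ) ≤ Q * (α * n) := by
    rw [← hfl, hQ]; exact_mod_cast hs1
  have hvE2 : (v:ℝ) / M.En n ≤ 1 / 2 := by
    refine le_trans ?_ h2
    rw [div_le_iff₀ hE0, hE]
    calc (v:ℝ) ≤ Q * (α * n) := hvQ
      _ = _ := by field_simp
  have hBin := aux_log_choose_ge (M.En n) v hv1 hvE2 hE1
  have hCN := hcn α n v hα hα1 hI hv1 hvQ hNc
  have hξ0 : 0 < α ^ M.ξexp := by positivity
  have hK3 : 2 * (v:ℝ) ^ 2 / M.En n ≤ n * (2 * Q ^ 2 * M.intlam * α ^ M.ξexp) := by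
    have hsq := M.aux_sq_le hα hα1
    calc 2 * (v:ℝ) ^ 2 / M.En n ≤ 2 * (Q * (α * n)) ^ 2 / M.En n := by gcongr
      _ = n * (2 * Q ^ 2 * M.intlam * α ^ 2) := by rw [hE]; field_simp
      _ ≤ _ := by gcongr
  set w0 : ℝ := j * (α * n) / i with hw0
  have hw00 : 0 < w0 := by positivity
  have hlv : Real.log ((v:ℝ) / M.En n) = Real.log v - Real.log (M.En n) := Real.log_div hv0.ne' hE0.ne'
  have hl0 : Real.log (j * α * M.intlam / i) = Real.log w0 - Real.log (M.En n) := by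
    rw [← Real.log_div hw00.ne' hE0.ne']
    congr 1
    rw [hw0, hE]; field_simp
  have hψr : 1 / M.ψ = 1 - 1 / M.r := by rw [one_div, aux_ψ_inv]
  have hψ1 : 0 < 1 / M.ψ := by positivity
  have hlog : Real.log ((v:ℝ) / M.En n) - Real.log (j * α * M.intlam / i) = Real.log (v / w0) := by
    rw [hlv, hl0, Real.log_div hv0.ne' hw00.ne']; ring
  have hfin : Real.log (M.NvCount n ⌊α * (n:ℝ)⌋₊ v) + Real.log (M.NcCount n v) - Real.log ((M.En n).choose v : ℝ)
      ≤ n * (M.auxMain i j α + ((Ka + Kb) + K2 + 2 * Q ^ 2 * M.intlam) * α ^ M.ξexp) + Real.log v + 1 := by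
    rw [M.aux_main_eq hmem hT hα]
    have hup : ∀ K, 0 ≤ K → K ≤ Ka + Kb → (n:ℝ) * (K * α ^ M.ξexp) ≤ n * ((Ka + Kb) * α ^ M.ξexp) := by
      intro K h0 h; gcongr
    rcases le_or_gt (v:ℝ) w0 with hvw | hvw
    · have h1 := hA α n v _ hα hα1 hI hNv rfl
      have h1' := hup Ka hKa (by linarith)
      refine aux_comb_alg n α i j v (M.En n) w0 (Real.log M.Cparam) M.r M.ψ _ _ 0 _ _ (Ka + Kb) K2 _ _ _ _ _ _ _
        hi'.ne' hψr hw0 ?_ hCN hBin hlv hK3 ?_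
      · linarith
      · rw [hlog, mul_zero, zero_add]
        have : Real.log (v / w0) ≤ 0 := Real.log_nonpos (by positivity) (by rw [div_le_one hw00]; exact hvw)
        have := mul_nonpos_of_nonneg_of_nonpos hv0.le this
        exact mul_nonpos_of_nonneg_of_nonpos hψ1.le this
    · have h1 := hB α n v _ hα hα1 hI hNv rfl
      have h1' := hup Kb hKb (by linarith)
      refine aux_comb_alg n α i j v (M.En n) w0 (Real.log M.Cparam) M.r M.ψ _ _ (U / M.ψ) _ _ (Ka + Kb) K2 _ _ _ _ _ _ _
        hi'.ne' hψr hw0 ?_ hCN hBin hlv hK3 ?_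
      · linarith
      · rw [hlog]
        have e1 : Real.log (v / w0) ≤ v / w0 - 1 := Real.log_le_sub_one_of_pos (by positivity)
        have e2 : (v:ℝ) ≤ U * w0 := by
          refine hvQ.trans (le_of_eq ?_)
          rw [hU, hw0]; field_simp
        have e3 : (v:ℝ) * Real.log (v / w0) ≤ U * (v - w0) := by
          calc (v:ℝ) * Real.log (v / w0) ≤ v * (v / w0 - 1) := by gcongr
            _ = (v / w0) * (v - w0) := by field_simp
            _ ≤ U * (v - w0) := by
              have : (v:ℝ) / w0 ≤ U := by rw [div_le_iff₀ hw00]; exact e2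
              have : 0 ≤ (v:ℝ) - w0 := by linarith
              gcongr
        have e4 := mul_le_mul_of_nonneg_left e3 hψ1.le
        have e5 : (w0 - v) * (U / M.ψ) = - (1 / M.ψ * (U * (v - w0))) := by ring
        linarith
  have hl1 := Real.log_le_log hpos hle
  rw [Real.log_mul (by positivity) (by positivity), Real.log_div (by positivity) (by positivity),
    Real.log_mul (by positivity) (by positivity)] at hl1
  have hlvE : Real.log (v:ℝ) ≤ Real.log ((M.En n : ℝ) + 1) := by
    refine Real.log_le_log hv0 ?_
    have : (v:ℝ) ≤ M.En n := by exact_mod_cast hvE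
    linarith
  have hlE0 : 0 ≤ Real.log ((M.En n : ℝ) + 1) := Real.log_nonneg (by linarith)
  have := aux_logE hI
  linarith

end DGLDPC

lemma aux_log_div_tendsto (c : ℝ) : Tendsto (fun n : ℕ => (4 * Real.log n + c) / (n:ℝ)) atTop (nhds 0) := by
  have h1 : Tendsto (fun n : ℕ => Real.log (n:ℝ) / (n:ℝ)) atTop (nhds 0) := by
    have := (Real.isLittleO_log_id_atTop.tendsto_div_nhds_zero).comp (tendsto_natCast_atTop_atTop (R := ℝ))
    exact this
  have h2 : Tendsto (fun n : ℕ => c / (n:ℝ)) atTop (nhds 0) := tendsto_const_div_atTop_nhds_zero_nat c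
  have h3 := (h1.const_mul 4).add h2
  simp only [mul_zero, add_zero] at h3
  refine h3.congr fun n => ?_
  ring

lemma aux_lim_upper (S : Set ℕ) (a : ℕ → ℝ) (c U G : ℝ) (hS : S.Infinite) (hS0 : ∀ n ∈ S, 0 < n)
    (hU : ∀ n ∈ S, a n ≤ n * U + (4 * Real.log n + c))
    (hG : Tendsto (fun n : ℕ => 1 / (n:ℝ) * a n) (atTop ⊓ 𝓟 S) (nhds G)) : G ≤ U := by
  have hne : (atTop ⊓ 𝓟 S : Filter ℕ).NeBot := by
    rw [← Filter.frequently_mem_iff_neBot]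
    exact Nat.frequently_atTop_iff_infinite.2 hS
  have h1 : Tendsto (fun n : ℕ => U + (4 * Real.log n + c) / (n:ℝ)) (atTop ⊓ 𝓟 S) (nhds U) := by
    have := ((aux_log_div_tendsto c).const_add U).mono_left (inf_le_left (b := 𝓟 S))
    simpa using this
  refine le_of_tendsto_of_tendsto hG h1 ?_
  have : ∀ᶠ n in (atTop ⊓ 𝓟 S), n ∈ S := eventually_inf_principal.2 (Eventually.of_forall fun n h => h)
  filter_upwards [this] with n hn
  have hn' : (0:ℝ) < n := by exact_mod_cast hS0 n hn
  have := hU n hn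
  calc 1 / (n:ℝ) * a n ≤ 1 / n * (n * U + (4 * Real.log n + c)) := by gcongr
    _ = _ := by field_simp

lemma aux_lim_lower (S : Set ℕ) (a : ℕ → ℝ) (c V G : ℝ) (f : ℕ → ℕ) (hf : Tendsto f atTop atTop)
    (hfS : ∀ k ≥ 1, f k ∈ S) (hS0 : ∀ n ∈ S, 0 < n)
    (hV : ∀ k ≥ 1, (f k : ℝ) * V - (4 * Real.log (f k) + c) ≤ a (f k))
    (hG : Tendsto (fun n : ℕ => 1 / (n:ℝ) * a n) (atTop ⊓ 𝓟 S) (nhds G)) : V ≤ G := by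
  have hf' : Tendsto f atTop (atTop ⊓ 𝓟 S) := tendsto_inf.2 ⟨hf, tendsto_principal.2
    (by filter_upwards [eventually_ge_atTop 1] with k hk using hfS k hk)⟩
  have h1 := hG.comp hf'
  have h2 : Tendsto (fun k : ℕ => V - (4 * Real.log (f k) + c) / (f k:ℝ)) atTop (nhds V) := by
    have := ((aux_log_div_tendsto c).comp hf).const_sub V
    simpa using this
  refine le_of_tendsto_of_tendsto h2 h1 ?_
  filter_upwards [eventually_ge_atTop 1] with k hk
  have hn' : (0:ℝ) < f k := by exact_mod_cast hS0 _ (hfS k hk)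
  have := hV k hk
  simp only [Function.comp]
  calc V - (4 * Real.log (f k) + c) / (f k:ℝ) = 1 / (f k:ℝ) * (f k * V - (4 * Real.log (f k) + c)) := by field_simp
    _ ≤ _ := by gcongr

/-- **Corollary 2.** Suppose `r > 2` or `p > 2`, and a single pair `(i,j)` achieves the
minimum defining `T` (possibly in several VN types).  Then
`G(α) = (T/ψ) α log α + K α + O(α^ξ)`, where
`K = (1/i)[ log(i ∑_{t ∈ Y_v} B_{i,j}^{(t)} δ_t) + (j/r) log C + (j/ψ) log(j ∫λ / i) ] - T/ψ`.
(The sum `∑_{t ∈ Y_v} B_{i,j}^{(t)} δ_t` is written over all VN types, which is the same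
since `B_{i,j}^{(t)} = 0` for `t ∉ Y_v` under the singleton hypothesis.) -/
theorem cor2_single_dominant_pair (M : DGLDPC) (h : 2 < M.r ∨ 2 < M.p) (i j : ℕ)
    (hmem : (i, j) ∈ M.Sminus ∧ M.Tij i j = M.T)
    (huniq : ∀ i' j' : ℕ, (i', j') ∈ M.Sminus → M.Tij i' j' = M.T → (i', j') = (i, j)) :
    ∃ k : ℝ, 0 < k ∧ ∃ ε : ℝ, 0 < ε ∧
      ∀ α : ℝ, 0 < α → α ≤ ε → {n : ℕ | M.Adm α n}.Infinite →
        ∃ G : ℝ,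
          Filter.Tendsto (M.grSeq α)
            (Filter.atTop ⊓ Filter.principal {n : ℕ | M.Adm α n}) (nhds G) ∧
          |G - ((M.T / M.ψ) * α * Real.log α +
              ((1 / (i : ℝ)) *
                  (Real.log ((i : ℝ) * ∑ t, (M.B t i j : ℝ) * M.δfrac t) +
                    ((j : ℝ) / (M.r : ℝ)) * Real.log M.Cparam +
                    ((j : ℝ) / M.ψ) * Real.log ((j : ℝ) * M.intlam / (i : ℝ))) -
                M.T / M.ψ) * α)| ≤ k * α ^ M.ξexp := by
  clear h
  obtain ⟨hmem, hT⟩ := hmem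
  obtain ⟨K1, hK1, hlow⟩ := M.aux_lower hmem hT
  obtain ⟨K2, hK2, hupp⟩ := M.aux_upper hmem hT huniq
  obtain ⟨hi, hj⟩ := M.aux_S_prop hmem
  have hr2 := M.aux_r_ge
  have ev1 := aux_ev 1 1 (by norm_num)
  obtain ⟨ε, hε, hsub⟩ := mem_nhdsGT_iff_exists_Ioc_subset.1 (hlow.and (hupp.and ev1))
  refine ⟨K1 + K2 + 1, by linarith, ε, hε, ?_⟩
  intro α hα hαε hinf
  obtain ⟨hL, hU, hα1⟩ := hsub ⟨hα, hαε⟩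
  rw [one_mul] at hα1
  have hξ : 0 < α ^ M.ξexp := Real.rpow_pos_of_pos hα _
  have hsq := M.aux_sq_le hα hα1
  have hS0 : ∀ n ∈ {n : ℕ | M.Adm α n}, 0 < n := fun n hn => hn.1
  obtain ⟨G, hG⟩ := aux_fekete {n : ℕ | M.Adm α n} (fun n => Real.log (M.ENw n ⌊α * (n:ℝ)⌋₊)) M.auxc
    (M.auxMain i j α + K2 * α ^ M.ξexp) hinf hS0 hU (fun n₁ h₁ n₀ h₀ => by
      obtain ⟨κ, hκ⟩ := DGLDPC.aux_sup h₁ h₀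
      exact ⟨κ, fun k _ => hκ k⟩)
  refine ⟨G, hG, ?_⟩
  change |G - M.auxMain i j α| ≤ _
  have hup := aux_lim_upper _ _ M.auxc _ G hinf hS0 hU hG
  obtain ⟨n₀, h₀⟩ := hinf.nonempty
  have hI₀ := DGLDPC.Adm.toInt h₀
  have hw : 1 ≤ ⌊α * (n₀:ℝ)⌋₊ := by
    have hn : (0:ℝ) < n₀ := by exact_mod_cast h₀.1
    have : (0:ℝ) < ⌊α * (n₀:ℝ)⌋₊ := by rw [hI₀.2.2.2.2]; positivity
    exact_mod_cast this
  have hir : 1 ≤ i * M.r := Nat.mul_pos hi (by omega)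
  have hfk : ∀ k ≥ 1, M.auxInt α (k * (i * M.r) * n₀) ∧
      ⌊α * ((k * (i * M.r) * n₀ : ℕ) : ℝ)⌋₊ = i * M.r * (k * ⌊α * (n₀:ℝ)⌋₊) := by
    intro k hk
    obtain ⟨N, hN⟩ : ∃ N, k * (i * M.r) = N + 1 := ⟨k * (i * M.r) - 1, by
      have : 1 ≤ k * (i * M.r) := Nat.mul_pos hk hir
      omega⟩
    have e : k * (i * M.r) * n₀ = n₀ + N * n₀ := by rw [hN]; ring
    obtain ⟨-, -, -, c4, c5⟩ := DGLDPC.auxInt.comb hI₀ hI₀ N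
    rw [e]
    refine ⟨c5, c4.trans ?_⟩
    calc _ = (N + 1) * ⌊α * (n₀:ℝ)⌋₊ := by ring
      _ = _ := by rw [← hN]; ring
  have hkey : ∀ k ≥ 1, _ := fun k hk => hL (k * (i * M.r) * n₀) (k * ⌊α * (n₀:ℝ)⌋₊) (hfk k hk).1 (hfk k hk).2
    (Nat.mul_pos hk hw)
  have hlo := aux_lim_lower {n : ℕ | M.Adm α n} (fun n => Real.log (M.ENw n ⌊α * (n:ℝ)⌋₊)) M.auxc
    (M.auxMain i j α - K1 * α ^ 2) G (fun k => k * (i * M.r) * n₀)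
    (tendsto_atTop_mono (fun k => by
      have : 1 ≤ n₀ := h₀.1
      calc k = k * 1 * 1 := by ring
        _ ≤ k * (i * M.r) * n₀ := by gcongr) tendsto_id)
    (fun k hk => by
      obtain ⟨a, b, c, d, e⟩ := (hfk k hk).1
      exact ⟨a, b, c, d, e, (hkey k hk).1⟩) hS0 (fun k hk => (hkey k hk).2) hG
  have hK1' : K1 * α ^ 2 ≤ K1 * α ^ M.ξexp := by gcongr
  have hK10 : 0 ≤ K1 * α ^ M.ξexp := by positivity
  have hK20 : 0 ≤ K2 * α ^ M.ξexp := by positivity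
  rw [abs_le]
  constructor <;> nlinarith
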